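/- arXiv:1610.04128 — 5 statements merged into one kernel-verified Lean document; each statement's English description precedes it below -/
import Mathlib

section
/- Every homogeneous polynomial of degree strictly greater than σ = (n+2)(d−2) lies in the Jacobian ideal (∂₀f,…,∂₍ₙ₊₁₎f); equivalently J(f)_ℓ = 0 for all ℓ > (n+2)(d−2). Consequently the Jacobian ring J(f) is a finite-dimensional ℂ-vector space. -/
open MvPolynomial

/-- The Jacobian ideal of `f`, generated by its partial derivatives. -/
noncomputable def jacIdeal (n : ℕ) (f : MvPolynomial (Fin (n + 2)) ℂ) :
    Ideal (MvPolynomial (Fin (n + 2)) ℂ) :=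
  Ideal.span (Set.range fun i : Fin (n + 2) => pderiv i f)

/-- The degree-`ℓ` graded piece of the Jacobian ring `J(f)`, namely the image in
`R/(∂₀f,…,∂₍ₙ₊₁₎f)` of the homogeneous polynomials of degree `ℓ`. -/
noncomputable def jacPiece (n : ℕ) (f : MvPolynomial (Fin (n + 2)) ℂ) (ℓ : ℕ) :
    Submodule ℂ (MvPolynomial (Fin (n + 2)) ℂ ⧸ jacIdeal n f) :=
  (homogeneousSubmodule (Fin (n + 2)) ℂ ℓ).map
    (Ideal.Quotient.mkₐ ℂ (jacIdeal n f)).toLinearMap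

namespace MvPolynomial

attribute [local instance] MvPolynomial.gradedAlgebra

section CommSemiring

variable {σ R : Type*} [CommSemiring R] {i n : ℕ} {a : MvPolynomial σ R}

lemma coe_decompose_homogeneousSubmodule (p : MvPolynomial σ R) (j : ℕ) :
    (DirectSum.decompose (homogeneousSubmodule σ R) p j : MvPolynomial σ R) =
      homogeneousComponent j p :=
  decomposition.decompose'_apply p j

lemma IsHomogeneous.homogeneousComponent_add_mul (ha : a.IsHomogeneous i) (j : ℕ)
    (b : MvPolynomial σ R) :
    homogeneousComponent (i + j) (a * b) = a * homogeneousComponent j b := by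
  simpa only [← coe_decompose_homogeneousSubmodule] using
    DirectSum.coe_decompose_mul_add_of_left_mem (homogeneousSubmodule σ R) (b := b) (j := j) ha

lemma IsHomogeneous.homogeneousComponent_mul_of_lt (ha : a.IsHomogeneous i) (h : n < i)
    (b : MvPolynomial σ R) : homogeneousComponent n (a * b) = 0 := by
  simpa only [← coe_decompose_homogeneousSubmodule] using
    DirectSum.coe_decompose_mul_of_left_mem_of_not_le (homogeneousSubmodule σ R) (b := b) ha
      (not_le.2 h)

lemma IsHomogeneous.mem_pow_idealOfVars (ha : a.IsHomogeneous i) (h : n ≤ i) :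
    a ∈ idealOfVars σ R ^ n := by
  rw [mem_pow_idealOfVars_iff]
  intro x hx
  have hx := ha (mem_support_iff.1 hx)
  rwa [Finsupp.degree_eq_weight_one, show Finsupp.weight (fun _ => 1) x = i from hx]

lemma IsHomogeneous.mem_idealOfVars (ha : a.IsHomogeneous i) (hi : 0 < i) :
    a ∈ idealOfVars σ R := by
  simpa using ha.mem_pow_idealOfVars (n := 1) hi

end CommSemiring

end MvPolynomial

namespace Ideal

/-- `l` is a regular sequence modulo `J`, listed with the last element at the head. -/
def IsRegularSeqMod {R : Type*} [CommRing R] (J : Ideal R) : List R → Prop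
  | [] => True
  | a :: l => J.IsRegularSeqMod l ∧ ∀ u, a * u ∈ J ⊔ ofList l → u ∈ J ⊔ ofList l

section CommRing

variable {R : Type*} [CommRing R] {J : Ideal R}

lemma IsRegularSeqMod.sup_span_singleton {c : R} :
    ∀ {l : List R}, J.IsRegularSeqMod l →
      (∀ t, t <:+ l → ∀ u, c * u ∈ J ⊔ ofList t → u ∈ J ⊔ ofList t) →
      (J ⊔ span {c}).IsRegularSeqMod l
  | [], _, _ => trivial
  | a :: l, h, hc => by
    refine ⟨h.1.sup_span_singleton fun t ht => hc t (ht.trans (List.suffix_cons a l)),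
      fun u hu => ?_⟩
    have hcons := hc (a :: l) List.suffix_rfl
    have key : J ⊔ ofList (a :: l) = (J ⊔ ofList l) ⊔ span {a} := by
      rw [ofList_cons, sup_comm (span {a}), sup_assoc]
    rw [key] at hcons
    have hreg := h.2
    rw [sup_right_comm] at hu ⊢
    generalize J ⊔ ofList l = K at *
    obtain ⟨p, hp, q, hq, hpq⟩ := Submodule.mem_sup.1 hu
    obtain ⟨v, rfl⟩ := mem_span_singleton'.1 hq
    have hv : v ∈ K ⊔ span {a} := by
      refine hcons v ?_
      rw [show c * v = u * a - p by linear_combination hpq]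
      exact sub_mem (mem_sup_right (mul_mem_left _ _ (mem_span_singleton_self a)))
        (mem_sup_left hp)
    obtain ⟨r, hr, s, hs, rfl⟩ := Submodule.mem_sup.1 hv
    obtain ⟨w, rfl⟩ := mem_span_singleton'.1 hs
    have : u - c * w ∈ K := by
      refine hreg _ ?_
      rw [show a * (u - c * w) = p + c * r by linear_combination -hpq]
      exact add_mem hp (mul_mem_left _ _ hr)
    rw [show u = (u - c * w) + w * c by ring]
    exact add_mem (mem_sup_left this)
      (mem_sup_right (mul_mem_left _ _ (mem_span_singleton_self c)))

lemma exists_mem_forall_mul_mem_imp {k : Type*} [Field k] [Infinite k] [Algebra k R]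
    [IsNoetherianRing R] (W : Submodule k R) {S : Set (Ideal R)} (hS : S.Finite)
    (h : ∀ Q ∈ S, ∀ u ∉ Q, ∃ w ∈ W, w * u ∉ Q) :
    ∃ c ∈ W, ∀ Q ∈ S, ∀ u, c * u ∈ Q → u ∈ Q := by
  classical
  have hfin : (⋃ Q ∈ S, associatedPrimes R (R ⧸ Q)).Finite :=
    hS.biUnion fun Q _ => associatedPrimes.finite R (R ⧸ Q)
  let T : Finset (Subspace k W) :=
    hfin.toFinset.image fun P => (P.restrictScalars k).comap W.subtype
  have hT : ⊤ ∉ T := by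
    intro hmem
    obtain ⟨P, hP, hPtop⟩ := Finset.mem_image.1 hmem
    simp only [Set.Finite.mem_toFinset, Set.mem_iUnion] at hP
    obtain ⟨Q, hQ, hP⟩ := hP
    rw [AssociatedPrimes.mem_iff, isAssociatedPrime_iff] at hP
    obtain ⟨hprime, x, rfl⟩ := hP
    obtain ⟨u, rfl⟩ := Ideal.Quotient.mk_surjective x
    have huQ : u ∉ Q := by
      intro hu
      apply hprime.ne_top
      rw [Ideal.Quotient.eq_zero_iff_mem.2 hu]
      simp
    obtain ⟨w, hw, hwu⟩ := h Q hQ u huQ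
    have : (⟨w, hw⟩ : W) ∈ (⊤ : Submodule k W) := trivial
    rw [← hPtop] at this
    have h2 : w • (Ideal.Quotient.mk Q u) = 0 := by
      simpa [Submodule.mem_colon_singleton] using this
    exact hwu (Ideal.Quotient.eq_zero_iff_mem.1 (by simpa [Algebra.smul_def] using h2))
  have hne := Subspace.biUnion_ne_univ_of_top_notMem hT
  obtain ⟨c, hc⟩ := (Set.ne_univ_iff_exists_notMem _).1 hne
  refine ⟨c, c.2, fun Q hQ u hu => by_contra fun huQ => hc ?_⟩
  have hmem : (c : R) ∈ ⋃ p ∈ associatedPrimes R (R ⧸ Q), (p : Set R) := by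
    rw [biUnion_associatedPrimes_eq_zero_divisors]
    refine ⟨Ideal.Quotient.mk Q u, fun h0 => huQ (Ideal.Quotient.eq_zero_iff_mem.1 h0), ?_⟩
    rw [Algebra.smul_def]
    exact Ideal.Quotient.eq_zero_iff_mem.2 hu
  simp only [Set.mem_iUnion] at hmem ⊢
  obtain ⟨P, hP, hcP⟩ := hmem
  exact ⟨_, Finset.mem_image_of_mem _
    (hfin.mem_toFinset.2 (Set.mem_biUnion hQ hP)), hcP⟩

end CommRing

end Ideal

namespace MvPolynomial

attribute [local instance] MvPolynomial.gradedAlgebra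

variable {σ k : Type*} [Field k]

/-- The quotient by `J` has a nonzero homogeneous socle element of degree `ℓ`. -/
def HasSocleDegree (J : Ideal (MvPolynomial σ k)) (ℓ : ℕ) : Prop :=
  ∃ u : MvPolynomial σ k, u.IsHomogeneous ℓ ∧ u ∉ J ∧ ∀ i, X i * u ∈ J

variable {J : Ideal (MvPolynomial σ k)} {α β ℓ : ℕ}

lemma mul_mem_of_mem_idealOfVars {u p : MvPolynomial σ k} (hu : ∀ i, X i * u ∈ J)
    (hp : p ∈ idealOfVars σ k) : p * u ∈ J := by
  have : idealOfVars σ k ≤ Submodule.comap (LinearMap.mulRight (MvPolynomial σ k) u) J := by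
    rw [Ideal.span_le]
    rintro _ ⟨i, rfl⟩
    exact hu i
  exact this hp

lemma exists_hasSocleDegree (hJ : J.IsHomogeneous (homogeneousSubmodule σ k)) (N : ℕ)
    {u : MvPolynomial σ k} (hu : u ∉ J) (h : ∀ p ∈ idealOfVars σ k ^ N, p * u ∈ J) :
    ∃ ℓ, HasSocleDegree J ℓ := by
  induction N with
  | zero => exact absurd (by simpa using h 1 (by simp)) hu
  | succ N ih =>
    by_cases hN : ∀ p ∈ idealOfVars σ k ^ N, p * u ∈ J
    · exact ih hN
    push Not at hN
    obtain ⟨v, hv, hvu⟩ := hN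
    rw [mem_iff_homogeneousComponent_mem hJ, not_forall] at hvu
    obtain ⟨ℓ, hℓ⟩ := hvu
    refine ⟨ℓ, _, homogeneousComponent_isHomogeneous ℓ (v * u), hℓ, fun i => ?_⟩
    rw [← (isHomogeneous_X k i).homogeneousComponent_add_mul]
    refine homogeneousComponent_mem_of_mem hJ ?_ _
    rw [← mul_assoc]
    refine h _ ?_
    rw [pow_succ']
    exact Ideal.mul_mem_mul (Ideal.subset_span ⟨i, rfl⟩) hv

lemma HasSocleDegree.exchange (hJ : J.IsHomogeneous (homogeneousSubmodule σ k))
    {a b : MvPolynomial σ k} (ha : a.IsHomogeneous α) (hb : b.IsHomogeneous β) (hβ : 0 < β)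
    (ha_reg : ∀ u, a * u ∈ J → u ∈ J) (hb_reg : ∀ u, b * u ∈ J → u ∈ J)
    (h : HasSocleDegree (J ⊔ Ideal.span {a}) ℓ) :
    ∃ ℓ', HasSocleDegree (J ⊔ Ideal.span {b}) ℓ' ∧ ℓ + β = ℓ' + α := by
  obtain ⟨u, hu, huJ, hXu⟩ := h
  obtain ⟨j, hj, s, hs, hbu⟩ :=
    Submodule.mem_sup.1 (mul_mem_of_mem_idealOfVars hXu (hb.mem_idealOfVars hβ))
  obtain ⟨v, rfl⟩ := Ideal.mem_span_singleton'.1 hs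
  have hbu' : b * u = j + a * v := by rw [← hbu, mul_comm a]
  have hcomp : b * u = homogeneousComponent (β + ℓ) j + homogeneousComponent (β + ℓ) (a * v) := by
    rw [← map_add, ← hbu', hb.homogeneousComponent_add_mul, homogeneousComponent_of_mem hu,
      if_pos rfl]
  have hj' := homogeneousComponent_mem_of_mem hJ hj (β + ℓ)
  rcases lt_or_ge (β + ℓ) α with hlt | hle
  · rw [ha.homogeneousComponent_mul_of_lt hlt, add_zero] at hcomp
    exact absurd (Ideal.mem_sup_left (hb_reg u (hcomp ▸ hj'))) huJ
  obtain ⟨ℓ', hℓ'⟩ := Nat.exists_eq_add_of_le hle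
  rw [hℓ', ha.homogeneousComponent_add_mul, ← hℓ'] at hcomp
  have hw := homogeneousComponent_isHomogeneous ℓ' v
  generalize homogeneousComponent ℓ' v = w at hcomp hw
  generalize homogeneousComponent (β + ℓ) j = q at hcomp hj'
  refine ⟨ℓ', ⟨w, hw, fun hwJ => huJ ?_, fun i => ?_⟩, by omega⟩
  · obtain ⟨r, hr, s, hs, rfl⟩ := Submodule.mem_sup.1 hwJ
    obtain ⟨t, rfl⟩ := Ideal.mem_span_singleton'.1 hs
    have : u - a * t ∈ J := by
      refine hb_reg _ ?_
      rw [show b * (u - a * t) = q + a * r by linear_combination hcomp]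
      exact add_mem hj' (J.mul_mem_left _ hr)
    rw [show u = (u - a * t) + t * a by ring]
    exact add_mem (Ideal.mem_sup_left this)
      (Ideal.mem_sup_right (Ideal.mul_mem_left _ _ (Ideal.mem_span_singleton_self a)))
  · obtain ⟨r, hr, s, hs, hrs⟩ := Submodule.mem_sup.1 (hXu i)
    obtain ⟨t, rfl⟩ := Ideal.mem_span_singleton'.1 hs
    have : X i * w - b * t ∈ J := by
      refine ha_reg _ ?_
      rw [show a * (X i * w - b * t) = b * r - X i * q by
        linear_combination -X i * hcomp - b * hrs]
      exact sub_mem (J.mul_mem_left _ hr) (J.mul_mem_left _ hj')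
    rw [show X i * w = (X i * w - b * t) + t * b by ring]
    exact add_mem (Ideal.mem_sup_left this)
      (Ideal.mem_sup_right (Ideal.mul_mem_left _ _ (Ideal.mem_span_singleton_self b)))

lemma isHomogeneous_ofList {l : List (MvPolynomial σ k)} (hl : ∀ a ∈ l, a.IsHomogeneous α) :
    (Ideal.ofList l).IsHomogeneous (homogeneousSubmodule σ k) :=
  Ideal.homogeneous_span _ _ fun a ha => ⟨α, hl a ha⟩

lemma exists_mul_notMem_of_suffix {a : MvPolynomial σ k} {l t : List (MvPolynomial σ k)}
    (hl : ∀ b ∈ a :: l, b.IsHomogeneous α) (hα : 0 < α) (h : J.IsRegularSeqMod (a :: l))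
    (ht : t <:+ l) {u : MvPolynomial σ k} (hu : u ∉ J ⊔ Ideal.ofList t) :
    ∃ w ∈ homogeneousSubmodule σ k 1, w * u ∉ J ⊔ Ideal.ofList t := by
  induction l generalizing a with
  | nil =>
    obtain rfl := List.suffix_nil.1 ht
    by_contra! hw
    exact hu (h.2 u (mul_mem_of_mem_idealOfVars (fun i => hw _ (isHomogeneous_X k i))
      ((hl a (by simp)).mem_idealOfVars hα)))
  | cons b l ih =>
    rcases List.suffix_cons_iff.1 ht with rfl | ht
    · by_contra! hw
      exact hu (h.2 u (mul_mem_of_mem_idealOfVars (fun i => hw _ (isHomogeneous_X k i))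
        ((hl a (by simp)).mem_idealOfVars hα)))
    · exact ih (fun b hb => hl b (List.mem_cons_of_mem _ hb)) h.1 ht

/-- The socle degree, corrected by the degrees of the sequence, does not depend on the choice of a
homogeneous regular sequence of given length. -/
lemma HasSocleDegree.of_isRegularSeqMod [Finite σ] [Infinite k] (hα : 0 < α) (hβ : 0 < β) :
    ∀ {as bs : List (MvPolynomial σ k)} {J : Ideal (MvPolynomial σ k)} {ℓ : ℕ},
      J.IsHomogeneous (homogeneousSubmodule σ k) → as.length = bs.length →
      (∀ a ∈ as, a.IsHomogeneous α) → (∀ b ∈ bs, b.IsHomogeneous β) →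
      J.IsRegularSeqMod as → J.IsRegularSeqMod bs → HasSocleDegree (J ⊔ Ideal.ofList as) ℓ →
      ∃ ℓ', HasSocleDegree (J ⊔ Ideal.ofList bs) ℓ' ∧
        ℓ + bs.length * β = ℓ' + as.length * α
  | [], [], J, ℓ, _, _, _, _, _, _, h => ⟨ℓ, h, by simp⟩
  | a :: as, b :: bs, J, ℓ, hJ, hlen, has, hbs, hra, hrb, h => by
    have has' : ∀ c ∈ as, c.IsHomogeneous α := fun c hc => has c (List.mem_cons_of_mem _ hc)
    have hbs' : ∀ c ∈ bs, c.IsHomogeneous β := fun c hc => hbs c (List.mem_cons_of_mem _ hc)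
    have hfin (l : List (MvPolynomial σ k)) :
        ((fun t => J ⊔ Ideal.ofList t) '' {t | t <:+ l}).Finite := by
      refine Set.Finite.image _ ((List.finite_toSet l.tails).subset fun t ht => ?_)
      exact (List.mem_tails t l).2 ht
    obtain ⟨c, hc, hreg⟩ := Ideal.exists_mem_forall_mul_mem_imp (homogeneousSubmodule σ k 1)
      ((hfin as).union (hfin bs)) (by
        rintro _ (⟨t, ht, rfl⟩ | ⟨t, ht, rfl⟩) u hu
        · exact exists_mul_notMem_of_suffix has hα hra ht hu
        · exact exists_mul_notMem_of_suffix hbs hβ hrb ht hu)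
    have hca : ∀ t, t <:+ as → ∀ u, c * u ∈ J ⊔ Ideal.ofList t → u ∈ J ⊔ Ideal.ofList t :=
      fun t ht => hreg _ (Or.inl ⟨t, ht, rfl⟩)
    have hcb : ∀ t, t <:+ bs → ∀ u, c * u ∈ J ⊔ Ideal.ofList t → u ∈ J ⊔ Ideal.ofList t :=
      fun t ht => hreg _ (Or.inr ⟨t, ht, rfl⟩)
    have hcons (x : MvPolynomial σ k) (l : List (MvPolynomial σ k)) :
        J ⊔ Ideal.ofList (x :: l) = (J ⊔ Ideal.ofList l) ⊔ Ideal.span {x} := by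
      rw [Ideal.ofList_cons, sup_comm (Ideal.span {x}), sup_assoc]
    rw [hcons] at h
    obtain ⟨ℓ₁, h₁, e₁⟩ := h.exchange (hJ.sup (isHomogeneous_ofList has')) (has a (by simp)) hc
      one_pos hra.2 (hca as List.suffix_rfl)
    rw [sup_right_comm] at h₁
    obtain ⟨ℓ₂, h₂, e₂⟩ := HasSocleDegree.of_isRegularSeqMod hα hβ
      (hJ.sup (Ideal.homogeneous_span _ _ fun x hx => ⟨1, (Set.mem_singleton_iff.1 hx) ▸ hc⟩))
      (by simpa using hlen) has' hbs' (hra.1.sup_span_singleton hca)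
      (hrb.1.sup_span_singleton hcb) h₁
    rw [sup_right_comm] at h₂
    obtain ⟨ℓ₃, h₃, e₃⟩ := h₂.exchange (hJ.sup (isHomogeneous_ofList hbs')) hc
      (hbs b (by simp)) hβ (hcb bs List.suffix_rfl) hrb.2
    rw [← hcons] at h₃
    refine ⟨ℓ₃, h₃, ?_⟩
    simp only [List.length_cons, add_mul]
    omega

lemma mem_ofList_map_X_of_X_mul_mem {s : List σ} {i : σ} (hi : i ∉ s) {u : MvPolynomial σ k}
    (h : X i * u ∈ Ideal.ofList (s.map (X : σ → MvPolynomial σ k))) :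
    u ∈ Ideal.ofList (s.map (X : σ → MvPolynomial σ k)) := by
  have key : Ideal.ofList (s.map (X : σ → MvPolynomial σ k)) = Ideal.span (X '' {i | i ∈ s}) := by
    simp only [Ideal.ofList, List.mem_map, Set.image, Set.mem_ofPred_eq]
  rw [key, mem_ideal_span_X_image] at h ⊢
  intro m hm
  obtain ⟨j, hj, hne⟩ := h (Finsupp.single i 1 + m) (by
    rwa [mem_support_iff, coeff_X_mul, ← mem_support_iff])
  refine ⟨j, hj, ?_⟩
  have hij : i ≠ j := fun e => hi (e ▸ hj)
  simpa [Finsupp.single_apply, hij] using hne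

lemma isRegularSeqMod_map_X : ∀ {s : List σ}, s.Nodup →
    (⊥ : Ideal (MvPolynomial σ k)).IsRegularSeqMod (s.map X)
  | [], _ => trivial
  | i :: s, h => by
    rw [List.nodup_cons] at h
    refine ⟨isRegularSeqMod_map_X h.2, fun u hu => ?_⟩
    rw [bot_sup_eq] at hu ⊢
    exact mem_ofList_map_X_of_X_mul_mem h.1 hu

lemma not_hasSocleDegree_ofList_map_X {s : List σ} {i : σ} (hi : i ∉ s) :
    ¬ HasSocleDegree (Ideal.ofList (s.map (X : σ → MvPolynomial σ k))) ℓ := by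
  rintro ⟨u, -, hu, hX⟩
  exact hu (mem_ofList_map_X_of_X_mul_mem hi (hX i))

lemma HasSocleDegree.eq_zero_of_idealOfVars_le (h : HasSocleDegree J ℓ)
    (hJ : idealOfVars σ k ≤ J) : ℓ = 0 := by
  obtain ⟨u, hu, huJ, -⟩ := h
  by_contra hℓ
  exact huJ (hJ (hu.mem_idealOfVars (Nat.pos_of_ne_zero hℓ)))

/-- Forms of the same degree that generate an ideal containing a power of the ideal of variables
have linear combinations forming a regular sequence of any length up to the number of variables. -/
lemma exists_isRegularSeqMod [Fintype σ] [Infinite k] {N : ℕ} (hα : 0 < α)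
    {W : Submodule k (MvPolynomial σ k)} [FiniteDimensional k W]
    (hW : W ≤ homogeneousSubmodule σ k α)
    (hN : idealOfVars σ k ^ N ≤ Ideal.span (W : Set (MvPolynomial σ k))) :
    ∀ n ≤ Fintype.card σ, ∃ l : List (MvPolynomial σ k), l.length = n ∧ (∀ a ∈ l, a ∈ W) ∧
      (⊥ : Ideal (MvPolynomial σ k)).IsRegularSeqMod l ∧
      n ≤ Module.finrank k (Submodule.span k {a | a ∈ l}) := by
  classical
  intro n
  induction n with
  | zero => exact fun _ => ⟨[], rfl, by simp, trivial, Nat.zero_le _⟩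
  | succ n ih =>
    intro hn
    obtain ⟨l, hlen, hlW, hreg, hrank⟩ := ih (by omega)
    have hlh : ∀ a ∈ l, a.IsHomogeneous α := fun a ha => hW (hlW a ha)
    have hhom := isHomogeneous_ofList hlh
    obtain ⟨c, hc, hcreg⟩ := Ideal.exists_mem_forall_mul_mem_imp W
      (Set.finite_singleton (Ideal.ofList l)) (by
        rintro _ rfl u hu
        by_contra! hw
        obtain ⟨ℓ, hℓ⟩ := exists_hasSocleDegree hhom N hu fun p hp => by
          have : Ideal.span (W : Set (MvPolynomial σ k)) ≤
              Submodule.comap (LinearMap.mulRight (MvPolynomial σ k) u) (Ideal.ofList l) :=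
            Ideal.span_le.2 hw
          exact this (hN hp)
        let s : List σ := Finset.univ.toList.take n
        have hs : s.Nodup := (Finset.nodup_toList _).sublist (List.take_sublist _ _)
        have hslen : s.length = n := by simp [s]; omega
        obtain ⟨i, hi⟩ : ∃ i, i ∉ s := by
          by_contra! hall
          have := Finset.card_le_card (fun i _ => List.mem_toFinset.2 (hall i) :
            Finset.univ ⊆ s.toFinset)
          have := List.toFinset_card_le s
          simp only [Finset.card_univ] at *
          omega
        rw [← bot_sup_eq (Ideal.ofList l)] at hℓ
        obtain ⟨ℓ', hℓ', -⟩ := hℓ.of_isRegularSeqMod hα one_pos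
          (Ideal.IsHomogeneous.bot _) (bs := s.map X) (by simp [hlen, hslen]) hlh
          (by simpa using fun i _ => isHomogeneous_X k i) hreg (isRegularSeqMod_map_X hs)
        rw [bot_sup_eq] at hℓ'
        exact not_hasSocleDegree_ofList_map_X hi hℓ')
    have hcreg := hcreg _ rfl
    refine ⟨c :: l, by simp [hlen], by simpa using ⟨hc, hlW⟩, ⟨hreg, by simpa using hcreg⟩, ?_⟩
    have hcl : c ∉ Submodule.span k {a | a ∈ l} := by
      intro hmem
      have hc' : c * 1 ∈ Ideal.ofList l := by
        rw [mul_one]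
        exact Submodule.span_le_restrictScalars k (MvPolynomial σ k) _ hmem
      have hle : Ideal.ofList l ≤ idealOfVars σ k :=
        Ideal.span_le.2 fun a ha => (hlh a ha).mem_idealOfVars hα
      have h1 := hle (hcreg 1 hc')
      rw [← pow_one (idealOfVars σ k), ← C_1, C_mem_pow_idealOfVars_iff] at h1
      simp at h1
    have hlt : Submodule.span k {a | a ∈ l} < Submodule.span k {a | a ∈ c :: l} := by
      refine lt_of_le_of_ne (Submodule.span_mono fun a ha => List.mem_cons_of_mem _ ha) ?_
      intro e
      exact hcl (e ▸ Submodule.subset_span (by simp))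
    have : FiniteDimensional k (Submodule.span k {a | a ∈ c :: l}) :=
      FiniteDimensional.span_of_finite k (List.finite_toSet _)
    exact Nat.succ_le_of_lt (hrank.trans_lt (Submodule.finrank_lt_finrank_of_lt hlt))

/-- Macaulay bound: if as many forms of degree `α + 1` as there are variables generate an ideal
containing a power of the ideal of variables, then this ideal contains all forms of degree greater
than `card σ * α`. -/
theorem mem_span_range_of_card_mul_lt [Fintype σ] [Infinite k] {N : ℕ}
    {g : σ → MvPolynomial σ k} (hg : ∀ i, (g i).IsHomogeneous (α + 1))
    (hN : idealOfVars σ k ^ N ≤ Ideal.span (Set.range g)) (hℓ : Fintype.card σ * α < ℓ)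
    {p : MvPolynomial σ k} (hp : p.IsHomogeneous ℓ) : p ∈ Ideal.span (Set.range g) := by
  set W := Submodule.span k (Set.range g)
  have : FiniteDimensional k W := FiniteDimensional.span_of_finite k (Set.finite_range g)
  have hWI : Ideal.span (W : Set (MvPolynomial σ k)) = Ideal.span (Set.range g) :=
    Submodule.span_span_of_tower k (MvPolynomial σ k) _
  obtain ⟨l, hlen, hlW, hreg, hrank⟩ := exists_isRegularSeqMod α.succ_pos
    (Submodule.span_le.2 (Set.range_subset_iff.2 hg) : W ≤ homogeneousSubmodule σ k (α + 1))
    (hWI ▸ hN) _ le_rfl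
  have hlspan : Submodule.span k {a | a ∈ l} = W :=
    Submodule.eq_of_le_of_finrank_le (Submodule.span_le.2 hlW)
      ((finrank_range_le_card g).trans hrank)
  have hlI : Ideal.ofList l = Ideal.span (Set.range g) := by
    rw [← hWI, ← hlspan]
    exact (Submodule.span_span_of_tower k (MvPolynomial σ k) _).symm
  have hlh : ∀ a ∈ l, a.IsHomogeneous (α + 1) := fun a ha =>
    (Submodule.span_le.2 (Set.range_subset_iff.2 hg) : W ≤ homogeneousSubmodule σ k (α + 1))
      (hlW a ha)
  rw [← hlI] at hN ⊢
  induction h : N - ℓ generalizing ℓ p with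
  | zero =>
    exact hN (hp.mem_pow_idealOfVars (by omega))
  | succ r ih =>
    by_contra hpI
    have hsoc : HasSocleDegree (⊥ ⊔ Ideal.ofList l) ℓ := by
      rw [bot_sup_eq]
      exact ⟨p, hp, hpI, fun i => ih (ℓ := 1 + ℓ) (by omega) ((isHomogeneous_X k i).mul hp)
        (by omega)⟩
    obtain ⟨ℓ', hℓ', e⟩ := hsoc.of_isRegularSeqMod α.succ_pos one_pos
      (Ideal.IsHomogeneous.bot _) (bs := (Finset.univ : Finset σ).toList.map X)
      (by simp [hlen]) hlh (by simpa using fun i => isHomogeneous_X k i) hreg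
      (isRegularSeqMod_map_X (Finset.nodup_toList _))
    have h0 := hℓ'.eq_zero_of_idealOfVars_le (by
      rw [bot_sup_eq]
      refine Ideal.span_mono ?_
      rintro _ ⟨i, rfl⟩
      simp)
    simp only [List.length_map, Finset.length_toList, Finset.card_univ, hlen, h0, Nat.succ_eq_add_one, mul_add] at e
    omega

/-- If the only common zero of the generators is the origin, the ideal contains a power of the
ideal of variables. -/
lemma exists_idealOfVars_pow_le [Finite σ] [IsAlgClosed k] {ι : Type*}
    {g : ι → MvPolynomial σ k} (h : ∀ x : σ → k, (∀ i, eval x (g i) = 0) → x = 0) :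
    ∃ N, idealOfVars σ k ^ N ≤ Ideal.span (Set.range g) := by
  obtain ⟨N, hN⟩ := (Ideal.span (Set.range g)).exists_radical_pow_le_of_fg
    (IsNoetherian.noetherian _)
  refine ⟨N, (Ideal.pow_right_mono ?_ N).trans hN⟩
  rw [Ideal.span_le, ← vanishingIdeal_zeroLocus_eq_radical (K := k)]
  rintro _ ⟨i, rfl⟩
  intro x hx
  have : x = 0 := h x fun j => by
    simpa using hx (g j) (Ideal.subset_span ⟨j, rfl⟩)
  simp [this]

lemma finiteDimensional_quotient_of_isHomogeneous_mem [Finite σ] {D : ℕ}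
    (h : ∀ ℓ, D < ℓ → ∀ p : MvPolynomial σ k, p.IsHomogeneous ℓ → p ∈ J) :
    FiniteDimensional k (MvPolynomial σ k ⧸ J) := by
  have : (LinearMap.range ((Ideal.Quotient.mkₐ k J).toLinearMap ∘ₗ
      (restrictTotalDegree σ k D).subtype)) = ⊤ := by
    rw [eq_top_iff]
    rintro y -
    obtain ⟨p, rfl⟩ := Ideal.Quotient.mk_surjective y
    rw [← sum_homogeneousComponent p, map_sum]
    refine sum_mem fun i _ => ?_
    have hi := homogeneousComponent_isHomogeneous i p
    rcases le_or_gt i D with hiD | hiD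
    · exact ⟨⟨_, (mem_restrictTotalDegree _ _ _).2 (hi.totalDegree_le.trans hiD)⟩, rfl⟩
    · rw [Ideal.Quotient.eq_zero_iff_mem.2 (h i hiD _ hi)]
      exact zero_mem _
  exact Module.Finite.of_surjective _ (LinearMap.range_eq_top.1 this)

end MvPolynomial

theorem jacobian_vanishes_above_top_degree (n d : ℕ) (hn : 1 ≤ n) (hd : 2 ≤ d)
    (f : MvPolynomial (Fin (n + 2)) ℂ) (hf : f.IsHomogeneous d)
    (hsm : ∀ x : Fin (n + 2) → ℂ, (∀ i, eval x (pderiv i f) = 0) → x = 0) :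
    (∀ ℓ : ℕ, (n + 2) * (d - 2) < ℓ →
        ∀ g : MvPolynomial (Fin (n + 2)) ℂ, g.IsHomogeneous ℓ → g ∈ jacIdeal n f) ∧
      (∀ ℓ : ℕ, (n + 2) * (d - 2) < ℓ → jacPiece n f ℓ = ⊥) ∧
      FiniteDimensional ℂ (MvPolynomial (Fin (n + 2)) ℂ ⧸ jacIdeal n f) := by
  obtain ⟨N, hN⟩ := exists_idealOfVars_pow_le hsm
  have hdeg (i : Fin (n + 2)) : (pderiv i f).IsHomogeneous (d - 2 + 1) := by
    rw [show d - 2 + 1 = d - 1 by omega]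
    exact hf.pderiv
  have main : ∀ ℓ : ℕ, (n + 2) * (d - 2) < ℓ →
      ∀ g : MvPolynomial (Fin (n + 2)) ℂ, g.IsHomogeneous ℓ → g ∈ jacIdeal n f :=
    fun ℓ hℓ g hg => mem_span_range_of_card_mul_lt hdeg hN (by simpa using hℓ) hg
  refine ⟨main, fun ℓ hℓ => ?_, finiteDimensional_quotient_of_isHomogeneous_mem main⟩
  rw [jacPiece, eq_bot_iff, Submodule.map_le_iff_le_comap]
  exact fun g hg => Ideal.Quotient.eq_zero_iff_mem.2 (main ℓ hℓ g hg)
end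

section
/- The graded piece of the Jacobian ring in top degree σ = (n+2)(d−2) is one-dimensional: dim_ℂ J(f)_{(n+2)(d−2)} = 1. -/
open MvPolynomial

section HilbertSeries

variable {σ K : Type*} [Field K]

/-- The image in `K[σ] ⧸ J` of the homogeneous polynomials of degree `ℓ`. -/
noncomputable def quotientPiece (J : Ideal (MvPolynomial σ K)) (ℓ : ℕ) :
    Submodule K (MvPolynomial σ K ⧸ J) :=
  (homogeneousSubmodule σ K ℓ).map (Ideal.Quotient.mkₐ K J).toLinearMap

/-- The Hilbert series of `K[σ] ⧸ J`. -/
noncomputable def hilbertSeries (J : Ideal (MvPolynomial σ K)) : PowerSeries ℤ :=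
  PowerSeries.mk fun ℓ => (Module.finrank K (quotientPiece J ℓ) : ℤ)

lemma mem_quotientPiece {J : Ideal (MvPolynomial σ K)} {ℓ : ℕ} {x : MvPolynomial σ K ⧸ J} :
    x ∈ quotientPiece J ℓ ↔ ∃ p : MvPolynomial σ K, p.IsHomogeneous ℓ ∧ Ideal.Quotient.mk J p = x :=
  Iff.rfl

instance [Finite σ] (J : Ideal (MvPolynomial σ K)) (ℓ : ℕ) :
    Module.Finite K (quotientPiece J ℓ) :=
  Module.Finite.iff_fg.mpr ((homogeneousSubmodule_fg σ K ℓ).map _)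

lemma finrank_map_add_finrank_inf_ker {V W : Type*} [AddCommGroup V] [Module K V]
    [AddCommGroup W] [Module K W] (φ : V →ₗ[K] W) (L : Submodule K V) [Module.Finite K L] :
    Module.finrank K (L.map φ) + Module.finrank K (L ⊓ LinearMap.ker φ : Submodule K V) =
      Module.finrank K L := by
  have h := (φ.domRestrict L).finrank_range_add_finrank_ker
  rw [LinearMap.range_domRestrict, LinearMap.ker_domRestrict,
    ← LinearMap.finrank_range_of_inj (f := L.subtype ∘ₗ
      ((LinearMap.ker φ).comap L.subtype).subtype) (by
        simp)] at h
  rwa [LinearMap.range_comp, Submodule.range_subtype, Submodule.map_comap_subtype] at h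

variable {J : Ideal (MvPolynomial σ K)} {w : MvPolynomial σ K} {e : ℕ}

/-- The projection `K[σ] ⧸ J → K[σ] ⧸ (J + (w))`. -/
noncomputable def quotientSupSpan (J : Ideal (MvPolynomial σ K)) (w : MvPolynomial σ K) :
    (MvPolynomial σ K ⧸ J) →ₗ[K] (MvPolynomial σ K ⧸ (J ⊔ Ideal.span {w})) :=
  (Ideal.Quotient.factorₐ K le_sup_left).toLinearMap

lemma quotientSupSpan_mk (p : MvPolynomial σ K) :
    quotientSupSpan J w (Ideal.Quotient.mk J p) = Ideal.Quotient.mk (J ⊔ Ideal.span {w}) p :=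
  rfl

lemma map_quotientSupSpan_quotientPiece (ℓ : ℕ) :
    (quotientPiece J ℓ).map (quotientSupSpan J w) = quotientPiece (J ⊔ Ideal.span {w}) ℓ := by
  rw [quotientPiece, ← Submodule.map_comp]
  rfl

attribute [local instance] MvPolynomial.gradedAlgebra in
lemma homogeneousComponent_sub_mem
    (hJ : J.IsHomogeneous (homogeneousSubmodule σ K)) {p q : MvPolynomial σ K} {ℓ : ℕ}
    (hp : p.IsHomogeneous ℓ) (h : p - q ∈ J) : p - homogeneousComponent ℓ q ∈ J := by
  simpa [homogeneousComponent_eq_self hp] using homogeneousComponent_mem_of_mem hJ h ℓ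

attribute [local instance] MvPolynomial.gradedAlgebra in
lemma homogeneousComponent_mul_of_isHomogeneous (hw : w.IsHomogeneous e) (q : MvPolynomial σ K)
    (ℓ : ℕ) : homogeneousComponent (ℓ + e) (q * w) = homogeneousComponent ℓ q * w := by
  have h := DirectSum.coe_decompose_mul_add_of_right_mem (homogeneousSubmodule σ K) (a := q)
    (i := ℓ) ((mem_homogeneousSubmodule _ _).2 hw)
  rwa [← decomposition.decompose'_apply, ← decomposition.decompose'_apply]

attribute [local instance] MvPolynomial.gradedAlgebra in
lemma homogeneousComponent_mul_of_lt (hw : w.IsHomogeneous e) (q : MvPolynomial σ K) {ℓ : ℕ}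
    (h : ℓ < e) : homogeneousComponent ℓ (q * w) = 0 := by
  have h := DirectSum.coe_decompose_mul_of_right_mem_of_not_le (homogeneousSubmodule σ K) (a := q)
    ((mem_homogeneousSubmodule _ _).2 hw) h.not_ge
  rwa [← decomposition.decompose'_apply]

lemma quotientSupSpan_mk_eq_zero {p : MvPolynomial σ K} :
    quotientSupSpan J w (Ideal.Quotient.mk J p) = 0 ↔ ∃ q, p - q * w ∈ J := by
  rw [quotientSupSpan_mk, Ideal.Quotient.eq_zero_iff_mem, sup_comm,
    Ideal.mem_span_singleton_sup]
  constructor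
  · rintro ⟨a, b, hb, rfl⟩
    exact ⟨a, by simpa⟩
  · rintro ⟨q, hq⟩
    exact ⟨q, _, hq, by ring⟩

attribute [local instance] MvPolynomial.gradedAlgebra in
lemma finrank_quotientPiece_sup_span_add [Finite σ]
    (hJ : J.IsHomogeneous (homogeneousSubmodule σ K)) (hw : w.IsHomogeneous e)
    (hreg : ∀ p, p * w ∈ J → p ∈ J) (ℓ : ℕ) :
    Module.finrank K (quotientPiece (J ⊔ Ideal.span {w}) (ℓ + e)) +
      Module.finrank K (quotientPiece J ℓ) = Module.finrank K (quotientPiece J (ℓ + e)) := by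
  have hinj : Function.Injective (LinearMap.mulRight K (Ideal.Quotient.mk J w)) := by
    rw [← LinearMap.ker_eq_bot, LinearMap.ker_eq_bot']
    intro x hx
    obtain ⟨p, rfl⟩ := Ideal.Quotient.mk_surjective x
    rw [LinearMap.mulRight_apply, ← map_mul, Ideal.Quotient.eq_zero_iff_mem] at hx
    exact Ideal.Quotient.eq_zero_iff_mem.2 (hreg p hx)
  have hker : quotientPiece J (ℓ + e) ⊓ LinearMap.ker (quotientSupSpan J w) =
      (quotientPiece J ℓ).map (LinearMap.mulRight K (Ideal.Quotient.mk J w)) := by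
    ext x
    simp only [Submodule.mem_inf, LinearMap.mem_ker, Submodule.mem_map, mem_quotientPiece,
      LinearMap.mulRight_apply]
    constructor
    · rintro ⟨⟨p, hp, rfl⟩, hx⟩
      obtain ⟨q, hq⟩ := quotientSupSpan_mk_eq_zero.1 hx
      have h := homogeneousComponent_sub_mem hJ hp hq
      rw [homogeneousComponent_mul_of_isHomogeneous hw] at h
      refine ⟨_, ⟨_, homogeneousComponent_isHomogeneous ℓ q, rfl⟩, ?_⟩
      rw [← map_mul]
      exact (Ideal.Quotient.eq.2 h).symm
    · rintro ⟨_, ⟨p, hp, rfl⟩, rfl⟩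
      rw [← map_mul]
      exact ⟨⟨_, hp.mul hw, rfl⟩, quotientSupSpan_mk_eq_zero.2 ⟨p, by simp⟩⟩
  rw [← map_quotientSupSpan_quotientPiece,
    ← finrank_map_add_finrank_inf_ker (quotientSupSpan J w) (quotientPiece J (ℓ + e)), hker,
    ← (Submodule.equivMapOfInjective _ hinj _).finrank_eq]

attribute [local instance] MvPolynomial.gradedAlgebra in
lemma finrank_quotientPiece_sup_span_of_lt [Finite σ]
    (hJ : J.IsHomogeneous (homogeneousSubmodule σ K)) (hw : w.IsHomogeneous e) {ℓ : ℕ}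
    (h : ℓ < e) :
    Module.finrank K (quotientPiece (J ⊔ Ideal.span {w}) ℓ) =
      Module.finrank K (quotientPiece J ℓ) := by
  have hker : quotientPiece J ℓ ⊓ LinearMap.ker (quotientSupSpan J w) = ⊥ := by
    rw [eq_bot_iff]
    rintro x ⟨⟨p, hp, rfl⟩, hx⟩
    obtain ⟨q, hq⟩ := quotientSupSpan_mk_eq_zero.1 hx
    have hpJ := homogeneousComponent_sub_mem hJ hp hq
    rw [homogeneousComponent_mul_of_lt hw q h, sub_zero] at hpJ
    exact Ideal.Quotient.eq_zero_iff_mem.2 hpJ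
  rw [← map_quotientSupSpan_quotientPiece,
    ← finrank_map_add_finrank_inf_ker (quotientSupSpan J w) (quotientPiece J ℓ), hker,
    finrank_bot, add_zero]

attribute [local instance] MvPolynomial.gradedAlgebra in
lemma hilbertSeries_sup_span [Finite σ]
    (hJ : J.IsHomogeneous (homogeneousSubmodule σ K)) (hw : w.IsHomogeneous e)
    (hreg : ∀ p, p * w ∈ J → p ∈ J) :
    hilbertSeries (J ⊔ Ideal.span {w}) = (1 - PowerSeries.X ^ e) * hilbertSeries J := by
  ext ℓ
  rw [sub_mul, one_mul, map_sub, PowerSeries.coeff_X_pow_mul']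
  simp only [hilbertSeries, PowerSeries.coeff_mk]
  split_ifs with h
  · obtain ⟨m, rfl⟩ := Nat.exists_eq_add_of_le' h
    rw [Nat.add_sub_cancel, ← finrank_quotientPiece_sup_span_add hJ hw hreg m]
    push_cast
    ring
  · rw [finrank_quotientPiece_sup_span_of_lt hJ hw (not_le.1 h), sub_zero]

lemma finrank_homogeneousSubmodule [Fintype σ] (ℓ : ℕ) :
    Module.finrank K (homogeneousSubmodule σ K ℓ) = (Fintype.card σ + ℓ - 1).choose ℓ := by
  classical
  have hs : {d : σ →₀ ℕ | d.degree = ℓ} = (Finset.univ.finsuppAntidiag ℓ : Finset (σ →₀ ℕ)) := by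
    ext d
    simp [Finset.mem_finsuppAntidiag, Finsupp.degree_eq_sum]
  rw [homogeneousSubmodule_eq_finsupp_supported, hs,
    (AddMonoidAlgebra.supportedEquivFinsupp _).finrank_eq, Module.finrank_finsupp_self]
  simp [Finset.card_finsuppAntidiag_nat_eq_choose]

lemma finrank_quotientPiece_bot (ℓ : ℕ) :
    Module.finrank K (quotientPiece (⊥ : Ideal (MvPolynomial σ K)) ℓ) =
      Module.finrank K (homogeneousSubmodule σ K ℓ) := by
  refine ((Submodule.equivMapOfInjective _ ?_ _).finrank_eq).symm
  rw [← LinearMap.ker_eq_bot, LinearMap.ker_eq_bot']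
  intro p hp
  exact Ideal.Quotient.eq_zero_iff_mem.1 hp

lemma hilbertSeries_bot_mul [Fintype σ] [Nonempty σ] :
    hilbertSeries (⊥ : Ideal (MvPolynomial σ K)) * (1 - PowerSeries.X) ^ Fintype.card σ = 1 := by
  obtain ⟨m, hm⟩ := Nat.exists_eq_succ_of_ne_zero (Fintype.card_ne_zero (α := σ))
  rw [hm]
  refine Eq.trans ?_ (PowerSeries.mk_add_choose_mul_one_sub_pow_eq_one ℤ m)
  congr 1
  ext ℓ
  rw [hilbertSeries, PowerSeries.coeff_mk, PowerSeries.coeff_mk, finrank_quotientPiece_bot,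
    finrank_homogeneousSubmodule, hm]
  congr 1
  rw [Nat.succ_add_sub_one, Nat.choose_symm_add]

end HilbertSeries

open Polynomial in
lemma coeff_of_mul_one_sub_X_pow_eq {F : PowerSeries ℤ} {N e : ℕ} (he : 1 ≤ e)
    (hF : F * (1 - PowerSeries.X) ^ N = (1 - PowerSeries.X ^ e) ^ N) :
    PowerSeries.coeff (N * (e - 1)) F = 1 := by
  have hG : F = (((∑ i ∈ Finset.range e, Polynomial.X ^ i) ^ N : ℤ[X]) : PowerSeries ℤ) := by
    have hne : (1 - PowerSeries.X : PowerSeries ℤ) ^ N ≠ 0 := by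
      refine pow_ne_zero _ fun h => ?_
      simpa using congrArg (PowerSeries.coeff 0) h
    refine mul_right_cancel₀ hne ?_
    have h := congrArg (fun p : ℤ[X] => (p : PowerSeries ℤ)) (geom_sum_mul_neg (X : ℤ[X]) e)
    simp only [Polynomial.coe_mul, Polynomial.coe_sub, Polynomial.coe_one, Polynomial.coe_X,
      Polynomial.coe_pow] at h
    rw [hF, Polynomial.coe_pow, ← mul_pow, h]
  have hm : (∑ i ∈ Finset.range e, Polynomial.X ^ i : ℤ[X]).Monic :=
    Polynomial.monic_geom_sum_X (by lia)
  have hdeg : (∑ i ∈ Finset.range e, Polynomial.X ^ i : ℤ[X]).natDegree = e - 1 := by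
    have h := congrArg Polynomial.natDegree (geom_sum_mul (Polynomial.X : ℤ[X]) e)
    rw [← Polynomial.C_1, hm.natDegree_mul (Polynomial.monic_X_sub_C 1),
      Polynomial.natDegree_X_sub_C, Polynomial.natDegree_X_pow_sub_C] at h
    lia
  rw [hG, Polynomial.coeff_coe, ← hdeg, Polynomial.coeff_pow_mul_natDegree, hm, one_pow]

section Depth

open CategoryTheory Abelian RingTheory.Sequence

open scoped Pointwise in
lemma subsingleton_ext_quotSMulTop {R : Type} [CommRing R] (N M : ModuleCat.{0} R) {x : R}
    (hx : IsSMulRegular M x) {n : ℕ} (h : ∀ i < n + 1, Subsingleton (Ext N M i)) :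
    ∀ i < n, Subsingleton (Ext N (ModuleCat.of R (QuotSMulTop x M)) i) := by
  intro i hi
  have zero1 := AddCommGrpCat.isZero_of_iff_subsingleton.mpr (h i (by lia))
  have zero2 := AddCommGrpCat.isZero_of_iff_subsingleton.mpr (h (i + 1) (by lia))
  exact AddCommGrpCat.subsingleton_of_isZero <| ShortComplex.Exact.isZero_of_both_zeros
    ((Ext.covariant_sequence_exact₃' N hx.smulShortComplex_shortExact) i (i + 1) rfl)
    (zero1.eq_zero_of_src _) (zero2.eq_zero_of_tgt _)

open scoped Pointwise in
lemma subsingleton_ext_quotient_sup_span {R : Type} [CommRing R] (N : ModuleCat.{0} R)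
    (J : Ideal R) {x : R} (hx : IsSMulRegular (R ⧸ J) x) {n : ℕ}
    (h : ∀ i < n + 1, Subsingleton (Ext N (ModuleCat.of R (R ⧸ J)) i)) :
    ∀ i < n, Subsingleton (Ext N (ModuleCat.of R (R ⧸ (J ⊔ Ideal.span {x}))) i) := by
  intro i hi
  have h1 := subsingleton_ext_quotSMulTop N (ModuleCat.of R (R ⧸ J)) hx h i hi
  have hmap : Submodule.map (Submodule.mkQ J) (Ideal.span {x}) = x • (⊤ : Submodule R (R ⧸ J)) := by
    rw [← Submodule.ideal_span_singleton_smul, ← Submodule.range_mkQ J, LinearMap.range_eq_map,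
      ← Submodule.map_smul'', smul_eq_mul, Ideal.mul_top]
  let e : QuotSMulTop x (R ⧸ J) ≃ₗ[R] R ⧸ (J ⊔ Ideal.span {x}) :=
    (Submodule.quotEquivOfEq _ _ hmap.symm).trans
      (Submodule.quotientQuotientEquivQuotientSup J (Ideal.span {x}))
  exact ((extFunctorObj N i).mapIso e.toModuleIso).addCommGroupIsoToAddEquiv.subsingleton_congr.1 h1

lemma exists_isSMulRegular_of_subsingleton_ext {K R : Type} [Field K] [Infinite K] [CommRing R]
    [Algebra K R] [IsNoetherianRing R] (W : Submodule K R)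
    (M : ModuleCat.{0} R) [Module.Finite R M]
    (h : Subsingleton (Ext (ModuleCat.of R (R ⧸ Ideal.span (W : Set R))) M 0)) :
    ∃ w ∈ W, IsSMulRegular M w := by
  have h1 : Subsingleton ((R ⧸ Ideal.span (W : Set R)) →ₗ[R] M) :=
    ((Ext.addEquiv₀ (X := ModuleCat.of R (R ⧸ Ideal.span (W : Set R))) (Y := M)).trans
      ModuleCat.homAddEquiv).symm.subsingleton
  obtain ⟨r, hr, hreg⟩ := IsSMulRegular.subsingleton_linearMap_iff.1 h1
  rw [Ideal.annihilator_quotient] at hr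
  by_contra! hW
  have hfin := associatedPrimes.finite R M
  have hcov : ⋃ p : associatedPrimes R M,
      (((p : Ideal R).restrictScalars K).comap W.subtype : Set W) = Set.univ := by
    rw [Set.eq_univ_iff_forall]
    intro w
    have hw : (w : R) ∈ ⋃ p ∈ associatedPrimes R M, (p : Set R) := by
      rw [biUnion_associatedPrimes_eq_compl_regular]
      exact hW w w.2
    simpa using hw
  have := hfin.to_subtype
  obtain ⟨p, hp⟩ := Subspace.exists_eq_top_of_iUnion_eq_univ hcov
  have hle : Ideal.span (W : Set R) ≤ p := by
    rw [Ideal.span_le]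
    intro w hw
    exact (hp ▸ Submodule.mem_top :
      (⟨w, hw⟩ : W) ∈ ((p : Ideal R).restrictScalars K).comap W.subtype)
  have : r ∈ ⋃ p ∈ associatedPrimes R M, (p : Set R) := Set.mem_biUnion p.2 (hle hr)
  rw [biUnion_associatedPrimes_eq_compl_regular] at this
  exact this hreg

lemma X_mul_mem_span_X_image {σ K : Type*} [Field K] {s : Set σ} {i : σ} (hi : i ∉ s)
    {p : MvPolynomial σ K} (h : X i * p ∈ Ideal.span (X '' s : Set (MvPolynomial σ K))) :
    p ∈ Ideal.span (X '' s : Set (MvPolynomial σ K)) := by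
  classical
  rw [mem_ideal_span_X_image] at h ⊢
  intro m hm
  obtain ⟨j, hj, hne⟩ := h (Finsupp.single i 1 + m) (by
    rw [mem_support_iff, coeff_X_mul]; exact mem_support_iff.1 hm)
  refine ⟨j, hj, ?_⟩
  have : i ≠ j := fun h => hi (h ▸ hj)
  simpa [Finsupp.single_apply, this] using hne

lemma isRegular_X (K : Type*) [Field K] (N : ℕ) :
    IsRegular (MvPolynomial (Fin N) K)
      ((List.finRange N).map (X : Fin N → MvPolynomial (Fin N) K)) := by
  have himg (l : List (Fin N)) : Ideal.ofList (l.map (X : Fin N → MvPolynomial (Fin N) K)) =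
      Ideal.span (X '' {i | i ∈ l}) := by
    rw [Ideal.ofList]
    congr 1
    ext p
    simp
  refine ⟨⟨fun k hk => ?_⟩, ?_⟩
  · rw [List.length_map, List.length_finRange] at hk
    rw [← List.map_take, himg, smul_eq_mul, Ideal.mul_top, List.getElem_map, List.getElem_finRange,
      isSMulRegular_quotient_iff_mem_of_smul_mem]
    intro p hp
    refine X_mul_mem_span_X_image (fun h => ?_) hp
    simp [List.mem_take_iff_getElem] at h
  · rw [himg, smul_eq_mul, Ideal.mul_top, ne_comm, Ideal.ne_top_iff_one, mem_ideal_span_X_image]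
    simp

lemma X_mem_radical_of_forall_eval_eq_zero {σ K : Type*} [Finite σ] [Field K] [IsAlgClosed K]
    {S : Set (MvPolynomial σ K)} (hS : ∀ x : σ → K, (∀ p ∈ S, eval x p = 0) → x = 0) (i : σ) :
    X i ∈ (Ideal.span S).radical := by
  rw [← vanishingIdeal_zeroLocus_eq_radical (K := K), mem_vanishingIdeal_iff]
  intro x hx
  have := hS x fun p hp => by simpa using hx p (Ideal.subset_span hp)
  simp [this]

end Depth

section Regular

open CategoryTheory Abelian RingTheory.Sequence

variable {K : Type} [Field K] {N e : ℕ}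

lemma subsingleton_ext_quotient_of_X_mem_radical {I : Ideal (MvPolynomial (Fin N) K)}
    (hI : ∀ i, X i ∈ I.radical) {J : Ideal (MvPolynomial (Fin N) K)} (hJ : J = ⊥) :
    ∀ i < N, Subsingleton (Ext (ModuleCat.of (MvPolynomial (Fin N) K) (MvPolynomial (Fin N) K ⧸ I))
      (ModuleCat.of (MvPolynomial (Fin N) K) (MvPolynomial (Fin N) K ⧸ J)) i) := by
  have hreg : IsRegular (MvPolynomial (Fin N) K ⧸ J)
      ((List.finRange N).map (X : Fin N → MvPolynomial (Fin N) K)) :=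
    ((Submodule.quotEquivOfEqBot J hJ).isRegular_congr _).2 (isRegular_X K N)
  have h := ModuleCat.subsingleton_ext_of_exists_isRegular
    (Ideal.ofList ((List.finRange N).map (X : Fin N → MvPolynomial (Fin N) K)))
    (ModuleCat.of (MvPolynomial (Fin N) K) (MvPolynomial (Fin N) K ⧸ I)) ?_
    (ModuleCat.of (MvPolynomial (Fin N) K) (MvPolynomial (Fin N) K ⧸ J))
    hreg.top_ne_smul.symm.lt_top _ (fun r hr => Ideal.subset_span hr) hreg
  · simpa using h
  · rw [Module.support_eq_zeroLocus, PrimeSpectrum.zeroLocus_subset_zeroLocus_iff,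
      Ideal.annihilator_quotient, Ideal.span_le]
    intro p hp
    obtain ⟨i, -, rfl⟩ := List.mem_map.1 hp
    exact hI i

attribute [local instance] MvPolynomial.gradedAlgebra in
lemma exists_le_finrank_eq_hilbertSeries_span_eq [Infinite K]
    {W : Submodule K (MvPolynomial (Fin N) K)} [Module.Finite K W]
    (he : 1 ≤ e) (hW : W ≤ homogeneousSubmodule (Fin N) K e)
    (hrad : ∀ i, X i ∈ (Ideal.span (W : Set (MvPolynomial (Fin N) K))).radical)
    {k : ℕ} (hk : k ≤ N) :
    ∃ V ≤ W, Module.finrank K V = k ∧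
      hilbertSeries (Ideal.span (V : Set (MvPolynomial (Fin N) K))) =
        (1 - PowerSeries.X ^ e) ^ k * hilbertSeries (⊥ : Ideal (MvPolynomial (Fin N) K)) ∧
      ∀ i < N - k, Subsingleton (Ext
        (ModuleCat.of (MvPolynomial (Fin N) K)
          (MvPolynomial (Fin N) K ⧸ Ideal.span (W : Set (MvPolynomial (Fin N) K))))
        (ModuleCat.of (MvPolynomial (Fin N) K)
          (MvPolynomial (Fin N) K ⧸ Ideal.span (V : Set (MvPolynomial (Fin N) K)))) i) := by
  induction k with
  | zero =>
    have h0 : Ideal.span ((⊥ : Submodule K (MvPolynomial (Fin N) K)) :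
        Set (MvPolynomial (Fin N) K)) = ⊥ := by simp
    exact ⟨⊥, bot_le, finrank_bot _ _, by rw [h0]; simp,
      subsingleton_ext_quotient_of_X_mem_radical hrad h0⟩
  | succ k ih =>
    obtain ⟨V, hVW, hV, hser, hext⟩ := ih (by lia)
    rw [show N - k = N - (k + 1) + 1 by lia] at hext
    obtain ⟨w, hwW, hreg⟩ := exists_isSMulRegular_of_subsingleton_ext W _ (hext 0 (by lia))
    have hreg' := (isSMulRegular_quotient_iff_mem_of_smul_mem _ _).1 hreg
    have hspan : Ideal.span ((V ⊔ Submodule.span K {w} : Submodule K (MvPolynomial (Fin N) K)) :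
        Set (MvPolynomial (Fin N) K)) =
        Ideal.span (V : Set (MvPolynomial (Fin N) K)) ⊔ Ideal.span {w} := by
      refine le_antisymm (Ideal.span_le.2 fun x hx => ?_) (sup_le
        (Ideal.span_mono (SetLike.coe_subset_coe.2 le_sup_left))
        ((Ideal.span_singleton_le_iff_mem _).2
          (Ideal.subset_span (Submodule.mem_sup_right (Submodule.mem_span_singleton_self w)))))
      obtain ⟨v, hv, c, hc, rfl⟩ := Submodule.mem_sup.1 hx
      obtain ⟨a, rfl⟩ := Submodule.mem_span_singleton.1 hc
      refine add_mem (Submodule.mem_sup_left (Ideal.subset_span hv)) (Submodule.mem_sup_right ?_)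
      rw [Algebra.smul_def]
      exact Ideal.mul_mem_left _ _ (Ideal.mem_span_singleton_self w)
    have hwV : w ∉ V := by
      intro hw
      have h1 : (1 : MvPolynomial (Fin N) K) ∈ Ideal.span (V : Set (MvPolynomial (Fin N) K)) :=
        hreg' 1 (by simpa using Ideal.subset_span hw)
      have h2 : Ideal.span (V : Set (MvPolynomial (Fin N) K)) ≤ RingHom.ker constantCoeff := by
        refine Ideal.span_le.2 fun v hv => ?_
        exact ((mem_homogeneousSubmodule _ _).1 (hW (hVW hv))).coeff_eq_zero (by simp; lia)
      simpa using h2 h1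
    have hhom : (Ideal.span (V : Set (MvPolynomial (Fin N) K))).IsHomogeneous
        (homogeneousSubmodule (Fin N) K) :=
      Ideal.homogeneous_span _ _ fun v hv => ⟨e, hW (hVW hv)⟩
    refine ⟨V ⊔ Submodule.span K {w}, sup_le hVW (by simpa using hwW), ?_, ?_, ?_⟩
    · have : FiniteDimensional K V := Submodule.finiteDimensional_of_le hVW
      have hw0 : w ≠ 0 := fun h => hwV (h ▸ V.zero_mem)
      have h := Submodule.finrank_sup_add_finrank_inf_eq V (Submodule.span K {w})
      rwa [(Submodule.disjoint_span_singleton_of_notMem hwV).eq_bot, finrank_bot, add_zero, hV,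
        finrank_span_singleton hw0] at h
    · rw [hspan, hilbertSeries_sup_span hhom (hW hwW)
        fun p hp => hreg' p (by rwa [smul_eq_mul, mul_comm]), hser]
      ring
    · rw [hspan]
      exact subsingleton_ext_quotient_sup_span _ _ hreg hext

lemma hilbertSeries_span_mul_eq [Infinite K] {g : Fin N → MvPolynomial (Fin N) K}
    (he : 1 ≤ e) (hg : ∀ i, (g i).IsHomogeneous e)
    (hrad : ∀ i, X i ∈ (Ideal.span (Set.range g)).radical) :
    hilbertSeries (Ideal.span (Set.range g)) =
        (1 - PowerSeries.X ^ e) ^ N * hilbertSeries (⊥ : Ideal (MvPolynomial (Fin N) K)) := by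
  have hspan : Ideal.span (Submodule.span K (Set.range g) : Set (MvPolynomial (Fin N) K)) =
      Ideal.span (Set.range g) := Submodule.span_span_of_tower _ _ _
  have hW : Submodule.span K (Set.range g) ≤ homogeneousSubmodule (Fin N) K e := by
    rw [Submodule.span_le]
    rintro _ ⟨i, rfl⟩
    exact hg i
  have : Module.Finite K (Submodule.span K (Set.range g)) :=
    Module.Finite.span_of_finite K (Set.finite_range g)
  obtain ⟨V, hVW, hV, hser, -⟩ :=
    exists_le_finrank_eq_hilbertSeries_span_eq he hW (by rwa [hspan]) le_rfl
  have hle : Module.finrank K (Submodule.span K (Set.range g)) ≤ Module.finrank K V := by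
    have h := finrank_range_le_card (R := K) g
    rw [Fintype.card_fin] at h
    rwa [hV]
  rw [← hspan, ← Submodule.eq_of_le_of_finrank_le hVW hle, hser]

end Regular

theorem jacobian_top_degree_piece_one_dimensional (n d : ℕ) (hn : 1 ≤ n) (hd : 2 ≤ d)
    (f : MvPolynomial (Fin (n + 2)) ℂ) (hf : f.IsHomogeneous d)
    (hsm : ∀ x : Fin (n + 2) → ℂ, (∀ i, eval x (pderiv i f) = 0) → x = 0) :
    Module.finrank ℂ (jacPiece n f ((n + 2) * (d - 2))) = 1 := by
  have hrad : ∀ i, X i ∈ (jacIdeal n f).radical :=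
    X_mem_radical_of_forall_eval_eq_zero fun x hx => hsm x fun i => hx _ ⟨i, rfl⟩
  have hser : hilbertSeries (jacIdeal n f) * (1 - PowerSeries.X) ^ (n + 2) =
      (1 - PowerSeries.X ^ (d - 1)) ^ (n + 2) := by
    have h := hilbertSeries_bot_mul (σ := Fin (n + 2)) (K := ℂ)
    rw [Fintype.card_fin] at h
    rw [jacIdeal, hilbertSeries_span_mul_eq (e := d - 1) (by lia) (fun i => hf.pderiv) hrad,
      mul_assoc, h, mul_one]
  have h := coeff_of_mul_one_sub_X_pow_eq (by lia) hser
  rw [hilbertSeries, PowerSeries.coeff_mk] at h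
  exact_mod_cast h
end

section
/- The Jacobian ring is Gorenstein with socle in degree σ = (n+2)(d−2): for every 0 ≤ ℓ ≤ σ, the multiplication pairing J(f)_ℓ × J(f)_{σ−ℓ} → J(f)_σ is nondegenerate, i.e. for every nonzero a ∈ J(f)_ℓ there exists b ∈ J(f)_{σ−ℓ} with a·b ≠ 0 in the one-dimensional space J(f)_σ. -/
open MvPolynomial

namespace GradedDuality

/-- `a` is a nonzerodivisor modulo the ideal `I`. -/
def NzdMod {R : Type*} [CommRing R] (I : Ideal R) (a : R) : Prop :=
  ∀ m, a * m ∈ I → m ∈ I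

section CommRing

variable {R : Type*} [CommRing R] {I : Ideal R} {a b g : R}

theorem mem_sup_span_singleton {x : R} :
    x ∈ I ⊔ Ideal.span {g} ↔ ∃ c, x - c * g ∈ I := by
  constructor
  · intro h
    obtain ⟨y, hy, z, hz, rfl⟩ := Submodule.mem_sup.1 h
    obtain ⟨c, rfl⟩ := Ideal.mem_span_singleton'.1 hz
    exact ⟨c, by simpa using hy⟩
  · rintro ⟨c, hc⟩
    exact Submodule.mem_sup.2 ⟨_, hc, c * g, Ideal.mem_span_singleton'.2 ⟨c, rfl⟩, by ring⟩

theorem NzdMod.pow (ha : NzdMod I a) (n : ℕ) : NzdMod I (a ^ n) := by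
  induction n with
  | zero => intro m hm; simpa using hm
  | succ n ih => intro m hm; exact ha _ (ih _ (by rwa [← mul_assoc, ← pow_succ]))

theorem NzdMod.of_mul_left (h : NzdMod I (a * b)) : NzdMod I a := fun m hm =>
  h m (by rw [mul_right_comm, mul_comm]; exact I.mul_mem_left _ hm)

theorem NzdMod.of_mul_right (h : NzdMod I (a * b)) : NzdMod I b :=
  NzdMod.of_mul_left (b := a) (by rwa [mul_comm])

theorem NzdMod.congr (ha : NzdMod I a) (hab : a - b ∈ I) : NzdMod I b := fun m hm =>
  ha m (by simpa [sub_mul] using I.add_mem (I.mul_mem_right m hab) hm)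

/-- If `a`, `b` is a regular sequence modulo `I` and `b` is regular modulo `I`, then `a` is
regular modulo `I + (b)`. -/
theorem NzdMod.swap (ha : NzdMod I a) (hb : NzdMod (I ⊔ Ideal.span {a}) b) :
    NzdMod (I ⊔ Ideal.span {b}) a := by
  intro m hm
  obtain ⟨c, hc⟩ := mem_sup_span_singleton.1 hm
  obtain ⟨u, hu⟩ := mem_sup_span_singleton.1 (hb c (mem_sup_span_singleton.2 ⟨m, by
    rw [← I.neg_mem_iff]; convert hc using 1; ring⟩))
  refine mem_sup_span_singleton.2 ⟨u, ha _ ?_⟩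
  convert I.add_mem hc (I.mul_mem_right b hu) using 1
  ring

end CommRing

section Graded

attribute [local instance] MvPolynomial.gradedAlgebra

variable {σ K : Type*} [Field K] {I : Ideal (MvPolynomial σ K)} {a b g y : MvPolynomial σ K}

theorem homogeneousComponent_mul_of_le {e n : ℕ} (hg : g.IsHomogeneous e) (h : e ≤ n) :
    homogeneousComponent n (a * g) = homogeneousComponent (n - e) a * g := by
  have := DirectSum.coe_decompose_mul_of_right_mem_of_le (homogeneousSubmodule σ K)
    (a := a) (b := g) hg h
  rw [← decomposition.decompose'_apply, ← decomposition.decompose'_apply]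
  exact this

theorem homogeneousComponent_mul_of_lt {e n : ℕ} (hg : g.IsHomogeneous e) (h : n < e) :
    homogeneousComponent n (a * g) = 0 := by
  have := DirectSum.coe_decompose_mul_of_right_mem_of_not_le (homogeneousSubmodule σ K)
    (a := a) (b := g) hg (not_le.2 h)
  rw [← decomposition.decompose'_apply]
  exact this

theorem isHomogeneous_span {ι : Type*} {h : ι → MvPolynomial σ K} {e : ι → ℕ}
    (hh : ∀ i, (h i).IsHomogeneous (e i)) (s : Set ι) :
    (Ideal.span (h '' s)).IsHomogeneous (homogeneousSubmodule σ K) := by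
  refine Ideal.homogeneous_span _ _ ?_
  rintro _ ⟨i, -, rfl⟩
  exact ⟨e i, hh i⟩

/-- A homogeneous element of `I + (g)` is congruent modulo `I` to a homogeneous multiple
of `g`. -/
theorem exists_homogeneous_of_mem_sup {ℓ e : ℕ} (hI : I.IsHomogeneous (homogeneousSubmodule σ K))
    (hg : g.IsHomogeneous e) (ha : a.IsHomogeneous ℓ) (h : a ∈ I ⊔ Ideal.span {g}) :
    a ∈ I ∨ ∃ c : MvPolynomial σ K, ∃ k, c.IsHomogeneous k ∧ k + e = ℓ ∧ a - c * g ∈ I := by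
  obtain ⟨c, hc⟩ := mem_sup_span_singleton.1 h
  have := homogeneousComponent_mem_of_mem hI hc ℓ
  rw [map_sub, homogeneousComponent_eq_self ha] at this
  rcases lt_or_ge ℓ e with hlt | hle
  · left
    rwa [homogeneousComponent_mul_of_lt hg hlt, sub_zero] at this
  · right
    rw [homogeneousComponent_mul_of_le hg hle] at this
    exact ⟨_, ℓ - e, homogeneousComponent_isHomogeneous _ _, by omega, this⟩

/-- If `a`, `b` is a homogeneous regular sequence modulo a homogeneous ideal, with `a` of positive
degree, then `b` is already regular. -/
theorem nzdMod_of_nzdMod_sup {e : ℕ} (hI : I.IsHomogeneous (homogeneousSubmodule σ K))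
    (he : 1 ≤ e) (hae : a.IsHomogeneous e)
    (ha : NzdMod I a) (hb : NzdMod (I ⊔ Ideal.span {a}) b) : NzdMod I b := by
  intro m hm
  have key : ∀ k : ℕ, ∃ c, b * c ∈ I ∧ m - c * a ^ k ∈ I := by
    intro k
    induction k with
    | zero => exact ⟨m, hm, by simp⟩
    | succ k ih =>
      obtain ⟨c, hc, hmc⟩ := ih
      obtain ⟨u, hu⟩ := mem_sup_span_singleton.1 (hb c (Ideal.mem_sup_left hc))
      refine ⟨u, ha _ ?_, ?_⟩
      · convert I.sub_mem hc (I.mul_mem_left b hu) using 1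
        ring
      · convert I.add_mem hmc (I.mul_mem_right (a ^ k) hu) using 1
        ring
  rw [mem_iff_homogeneousComponent_mem hI]
  intro n
  obtain ⟨c, -, hc⟩ := key (n + 1)
  have := homogeneousComponent_mem_of_mem hI hc n
  rwa [map_sub, homogeneousComponent_mul_of_lt (hae.pow (n + 1)) (by nlinarith), sub_zero] at this

/-- Nondegeneracy of the multiplication pairing on the graded quotient by `I`, with values in
degree `s`. -/
def Nondegenerate (I : Ideal (MvPolynomial σ K)) (s : ℕ) : Prop :=
  ∀ (ℓ : ℕ) (a : MvPolynomial σ K), a.IsHomogeneous ℓ → a ∉ I →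
    ∃ (k : ℕ) (b : MvPolynomial σ K), b.IsHomogeneous k ∧ ℓ + k = s ∧ a * b ∉ I

theorem Nondegenerate.pow {s : ℕ} (hI : I.IsHomogeneous (homogeneousSubmodule σ K))
    (hy : y.IsHomogeneous 1) (hreg : NzdMod I y) (h : Nondegenerate (I ⊔ Ideal.span {y}) s)
    (M : ℕ) : Nondegenerate (I ⊔ Ideal.span {y ^ (M + 1)}) (s + M) := by
  induction M with
  | zero => simpa using h
  | succ M ih =>
    intro ℓ a ha hna
    by_cases hay : a ∈ I ⊔ Ideal.span {y}
    · rcases exists_homogeneous_of_mem_sup hI hy ha hay with haI | ⟨c, k, hc, hk, hac⟩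
      · exact (hna (Ideal.mem_sup_left haI)).elim
      · have hcn : c ∉ I ⊔ Ideal.span {y ^ (M + 1)} := fun hmem => by
          obtain ⟨u, hu⟩ := mem_sup_span_singleton.1 hmem
          refine hna (mem_sup_span_singleton.2 ⟨u, ?_⟩)
          convert I.add_mem hac (I.mul_mem_right y hu) using 1
          ring
        obtain ⟨j, b, hb, hj, hcb⟩ := ih k c hc hcn
        refine ⟨j, b, hb, by omega, fun hmem => hcb ?_⟩
        obtain ⟨u, hu⟩ := mem_sup_span_singleton.1 hmem
        refine mem_sup_span_singleton.2 ⟨u, hreg _ ?_⟩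
        convert I.sub_mem hu (I.mul_mem_right b hac) using 1
        ring
    · obtain ⟨k, b, hb, hk, hab⟩ := h ℓ a ha hay
      refine ⟨k + (M + 1), b * y ^ (M + 1), by simpa using hb.mul (hy.pow (M + 1)), by omega,
        fun hmem => hab ?_⟩
      obtain ⟨u, hu⟩ := mem_sup_span_singleton.1 hmem
      refine mem_sup_span_singleton.2 ⟨u, hreg.pow (M + 1) _ ?_⟩
      convert hu using 1
      ring

/-- Nondegeneracy modulo `I + (y)`, with `y` linear, passes to `I + (g)` as soon as some power of
`y` lies in `I + (g)`. -/
theorem Nondegenerate.exchange {s e : ℕ} (hI : I.IsHomogeneous (homogeneousSubmodule σ K))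
    (hy : y.IsHomogeneous 1) (hreg : NzdMod I y) (h : Nondegenerate (I ⊔ Ideal.span {y}) s)
    (hg : g.IsHomogeneous e) (hyg : y ∈ (I ⊔ Ideal.span {g}).radical) :
    NzdMod I g ∧ Nondegenerate (I ⊔ Ideal.span {g}) (s + e - 1) := by
  obtain ⟨N, hN⟩ := hyg
  have hN' : y ^ (N + e + 1) ∈ I ⊔ Ideal.span {g} := by
    rw [add_assoc, pow_add]
    exact Ideal.mul_mem_right _ _ hN
  have hdeg : (y ^ (N + e + 1)).IsHomogeneous (N + e + 1) := by simpa using hy.pow (N + e + 1)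
  obtain ⟨c, k, hc, hk, hyc⟩ : ∃ c : MvPolynomial σ K, ∃ k, c.IsHomogeneous k ∧
      k + e = N + e + 1 ∧ y ^ (N + e + 1) - c * g ∈ I := by
    rcases exists_homogeneous_of_mem_sup hI hg hdeg hN' with hmem | hex
    · have h1 : (1 : MvPolynomial σ K) ∈ I := hreg.pow (N + e + 1) 1 (by simpa using hmem)
      have hall : ∀ x, x ∈ I := fun x => by simpa using I.mul_mem_left x h1
      exact ⟨0, N + 1, isHomogeneous_zero _ _ _, by omega, hall _⟩
    · exact hex
  have hcg : NzdMod I (c * g) := (hreg.pow (N + e + 1)).congr hyc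
  have hcreg := hcg.of_mul_left
  refine ⟨hcg.of_mul_right, fun ℓ a ha hna => ?_⟩
  have hca : c * a ∉ I ⊔ Ideal.span {y ^ (N + e + 1)} := fun hmem => by
    obtain ⟨u, hu⟩ := mem_sup_span_singleton.1 hmem
    refine hna (mem_sup_span_singleton.2 ⟨u, hcreg _ ?_⟩)
    convert I.add_mem hu (I.mul_mem_left u hyc) using 1
    ring
  obtain ⟨j, b, hb, hj, hcab⟩ := h.pow hI hy hreg (N + e) _ _ (hc.mul ha) hca
  refine ⟨j, b, hb, by omega, fun hmem => hcab ?_⟩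
  obtain ⟨u, hu⟩ := mem_sup_span_singleton.1 hmem
  refine mem_sup_span_singleton.2 ⟨u, ?_⟩
  convert I.sub_mem (I.mul_mem_left c hu) (I.mul_mem_left u hyc) using 1
  ring

end Graded

section StronglyRegular

attribute [local instance] MvPolynomial.gradedAlgebra

variable {ι σ K : Type*} [Field K] {h : ι → MvPolynomial σ K}

/-- Every ordering of every subfamily of `h` is a weakly regular sequence. -/
def StronglyRegular {R : Type*} [CommRing R] (h : ι → R) : Prop :=
  ∀ (T : Finset ι) (i : ι), i ∉ T → NzdMod (Ideal.span (h '' T)) (h i)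

theorem span_image_insert {R : Type*} [CommRing R] [DecidableEq ι] (h : ι → R) (i : ι)
    (T : Finset ι) :
    Ideal.span (h '' ↑(insert i T)) = Ideal.span (h '' T) ⊔ Ideal.span {h i} := by
  rw [Finset.coe_insert, Set.image_insert_eq, Ideal.span_insert, sup_comm]

theorem image_update_of_notMem {R : Type*} [DecidableEq ι] (h : ι → R) {i : ι} (g : R)
    {T : Finset ι} (hi : i ∉ T) : Function.update h i g '' T = h '' T :=
  Set.image_congr fun j hj => Function.update_of_ne (fun hji => hi (by simpa [← hji] using hj)) _ _

theorem span_range_eq_sup {R : Type*} [CommRing R] [Fintype ι] [DecidableEq ι] (h : ι → R)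
    (i : ι) : Ideal.span (Set.range h) =
      Ideal.span (h '' ↑(Finset.univ.erase i)) ⊔ Ideal.span {h i} := by
  rw [← span_image_insert, Finset.insert_erase (Finset.mem_univ i), Finset.coe_univ,
    Set.image_univ]

/-- A strongly regular homogeneous family stays strongly regular when one member is replaced by
an element that is regular modulo the other members. -/
theorem StronglyRegular.update [Fintype ι] [DecidableEq ι] {e : ι → ℕ}
    (hh : ∀ i, (h i).IsHomogeneous (e i)) (he : ∀ i, 1 ≤ e i) (hreg : StronglyRegular h)
    {i : ι} {g : MvPolynomial σ K}
    (hg : NzdMod (Ideal.span (h '' ↑(Finset.univ.erase i))) g) :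
    StronglyRegular (Function.update h i g) := by
  have key : ∀ S T : Finset ι, T ∪ S = Finset.univ.erase i →
      NzdMod (Ideal.span (h '' T)) g := by
    intro S
    induction S using Finset.induction_on with
    | empty => intro T hT; rw [Finset.union_empty] at hT; rwa [hT]
    | insert k S hk ih =>
      intro T hT
      by_cases hkT : k ∈ T
      · exact ih T (by rw [← hT, Finset.union_insert, Finset.insert_eq_of_mem
          (Finset.mem_union_left _ hkT)])
      · refine nzdMod_of_nzdMod_sup (isHomogeneous_span hh _) (he k) (hh k) (hreg T k hkT) ?_
        rw [← span_image_insert]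
        exact ih _ (by rw [← hT, Finset.union_insert, Finset.insert_union])
  have key' : ∀ T : Finset ι, i ∉ T → NzdMod (Ideal.span (h '' T)) g := fun T hT =>
    key (Finset.univ.erase i) T (Finset.union_eq_right.2 fun j hj =>
      Finset.mem_erase.2 ⟨fun hji => hT (hji ▸ hj), Finset.mem_univ j⟩)
  intro T j hjT
  by_cases hiT : i ∈ T
  · have hji : j ≠ i := fun hji => hjT (hji ▸ hiT)
    have hi' := Finset.notMem_erase i T
    have hj' : j ∉ T.erase i := fun hj => hjT (Finset.mem_of_mem_erase hj)
    rw [← Finset.insert_erase hiT, span_image_insert, image_update_of_notMem _ _ hi',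
      Function.update_self, Function.update_of_ne hji]
    refine (hreg _ j hj').swap ?_
    rw [← span_image_insert]
    exact key' _ (by simp [hji.symm])
  · rw [image_update_of_notMem _ _ hiT]
    by_cases hji : j = i
    · subst hji
      simpa using key' T hiT
    · rw [Function.update_of_ne hji]
      exact hreg T j hjT

theorem stronglyRegular_X : StronglyRegular (X : σ → MvPolynomial σ K) := by
  classical
  intro T i hi m hm
  rw [mem_ideal_span_X_image] at hm ⊢
  intro d hd
  obtain ⟨j, hj, hjd⟩ := hm (Finsupp.single i 1 + d) (by
    rw [mem_support_iff, coeff_X_mul]; exact mem_support_iff.1 hd)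
  refine ⟨j, hj, ?_⟩
  have hij : i ≠ j := fun hij => hi (by simpa [hij] using hj)
  simpa [Finsupp.single_apply, hij] using hjd

theorem StronglyRegular.map {R S : Type*} [CommRing R] [CommRing S] (φ : R ≃+* S) {h : ι → R}
    (hreg : StronglyRegular h) : StronglyRegular (φ ∘ h) := by
  intro T i hi m hm
  have hspan : Ideal.span ((φ ∘ h) '' T) = (Ideal.span (h '' T)).map φ := by
    rw [Ideal.map_span, Set.image_comp]
  rw [hspan, ← Ideal.comap_symm, Ideal.mem_comap] at hm ⊢
  exact hreg T i hi _ (by simpa using hm)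

end StronglyRegular

section Linear

variable {σ K : Type*} [Field K]

theorem IsHomogeneous.mem_idealOfVars_pow {a : MvPolynomial σ K} {n D : ℕ}
    (ha : a.IsHomogeneous n) (h : D ≤ n) : a ∈ idealOfVars σ K ^ D := by
  rw [mem_pow_idealOfVars_iff']
  intro d hd
  exact ha.coeff_eq_zero (by omega)

theorem nondegenerate_idealOfVars : Nondegenerate (idealOfVars σ K) 0 := by
  intro ℓ a ha hna
  have hℓ : ℓ = 0 := by
    by_contra hne
    exact hna (by simpa using IsHomogeneous.mem_idealOfVars_pow (D := 1) ha (by omega))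
  exact ⟨0, 1, isHomogeneous_one _ _, by omega, by simpa using hna⟩

variable [Fintype σ] {h : σ → MvPolynomial σ K}

theorem sum_C_mul_sum_C_mul [DecidableEq σ] {A B : Matrix σ σ K} (hAB : A * B = 1)
    (v : σ → MvPolynomial σ K) (i : σ) : ∑ j, C (A i j) * ∑ k, C (B j k) * v k = v i :=
  calc _ = ∑ k, C ((A * B) i k) * v k := by
        simp_rw [Matrix.mul_apply, map_sum, Finset.sum_mul, Finset.mul_sum, map_mul, mul_assoc]
        exact Finset.sum_comm
    _ = v i := by simp [hAB, Matrix.one_apply]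

/-- Linear forms without a nontrivial common zero are obtained from the variables by an invertible
matrix. -/
theorem exists_matrix_of_linear [DecidableEq σ] (hh : ∀ i, (h i).IsHomogeneous 1)
    (hsop : ∀ x, (∀ i, eval x (h i) = 0) → x = 0) :
    ∃ A B : Matrix σ σ K, A * B = 1 ∧ B * A = 1 ∧ ∀ i, h i = ∑ j, C (A i j) * X j := by
  have hA : ∀ i, ∃ c : σ → K, ∑ j, c j • (X j : MvPolynomial σ K) = h i := fun i => by
    rw [← Submodule.mem_span_range_iff_exists_fun, ← homogeneousSubmodule_one_eq_span_X]
    exact hh i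
  choose A hA using hA
  have hdet : IsUnit (Matrix.of A).det := by
    rw [isUnit_iff_ne_zero]
    intro hdet
    obtain ⟨v, hv, hAv⟩ := Matrix.exists_mulVec_eq_zero_iff.2 hdet
    refine hv (hsop v fun i => ?_)
    rw [← hA i]
    simpa [Matrix.mulVec, dotProduct, smul_eval] using congrFun hAv i
  exact ⟨Matrix.of A, (Matrix.of A)⁻¹, Matrix.mul_nonsing_inv _ hdet,
    Matrix.nonsing_inv_mul _ hdet, fun i => by simp [← hA i, smul_eq_C_mul]⟩

theorem stronglyRegular_of_linear (hh : ∀ i, (h i).IsHomogeneous 1)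
    (hsop : ∀ x, (∀ i, eval x (h i) = 0) → x = 0) : StronglyRegular h := by
  classical
  obtain ⟨A, B, hAB, hBA, hA⟩ := exists_matrix_of_linear hh hsop
  let φ : MvPolynomial σ K ≃ₐ[K] MvPolynomial σ K :=
    AlgEquiv.ofAlgHom (aeval h) (aeval fun j => ∑ k, C (B j k) * X k)
      (algHom_ext fun j => by
        simpa [algebraMap_eq, ← hA] using sum_C_mul_sum_C_mul hBA X j)
      (algHom_ext fun i => by
        simpa [algebraMap_eq, hA] using sum_C_mul_sum_C_mul hAB X i)
  convert (stronglyRegular_X (σ := σ) (K := K)).map φ.toRingEquiv using 1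
  ext1 i
  simp [φ]

theorem nondegenerate_of_linear (hh : ∀ i, (h i).IsHomogeneous 1)
    (hsop : ∀ x, (∀ i, eval x (h i) = 0) → x = 0) :
    Nondegenerate (Ideal.span (Set.range h)) 0 := by
  classical
  obtain ⟨A, B, -, hBA, hA⟩ := exists_matrix_of_linear hh hsop
  have hspan : Ideal.span (Set.range h) = idealOfVars σ K := by
    refine le_antisymm (Ideal.span_le.2 ?_) (Ideal.span_le.2 ?_)
    · rintro _ ⟨i, rfl⟩
      simpa using IsHomogeneous.mem_idealOfVars_pow (D := 1) (hh i) le_rfl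
    · rintro _ ⟨j, rfl⟩
      rw [← sum_C_mul_sum_C_mul hBA X j]
      simp_rw [← hA]
      exact Ideal.sum_mem _ fun i _ => Ideal.mul_mem_left _ _ (Ideal.subset_span ⟨i, rfl⟩)
  rw [hspan]
  exact nondegenerate_idealOfVars

end Linear

section Parameters

attribute [local instance] MvPolynomial.gradedAlgebra

variable {σ K : Type*} [Fintype σ] [Field K] {h : σ → MvPolynomial σ K} {e : σ → ℕ}

theorem IsHomogeneous.eval_smul {p : MvPolynomial σ K} {n : ℕ} (hp : p.IsHomogeneous n) (c : K)
    (x : σ → K) : eval (c • x) p = c ^ n * eval x p := by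
  rw [eval_eq', eval_eq', Finset.mul_sum]
  refine Finset.sum_congr rfl fun d hd => ?_
  simp only [Pi.smul_apply, smul_eq_mul, mul_pow, Finset.prod_mul_distrib,
    Finset.prod_pow_eq_pow_sum]
  have hdn : ∑ i, d i = n := by
    rw [← Finsupp.degree_eq_sum]
    by_contra hne
    exact mem_support_iff.1 hd (hp.coeff_eq_zero hne)
  rw [hdn]
  ring

variable [IsAlgClosed K]

theorem idealOfVars_le_radical (hsop : ∀ x, (∀ i, eval x (h i) = 0) → x = 0) :
    idealOfVars σ K ≤ (Ideal.span (Set.range h)).radical := by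
  rw [← vanishingIdeal_zeroLocus_eq_radical (K := K), Ideal.span_le]
  rintro _ ⟨j, rfl⟩ x hx
  have : x = 0 := hsop x fun i => by
    simpa [aeval_eq_eval] using hx (h i) (Ideal.subset_span ⟨i, rfl⟩)
  simp [this]

variable [DecidableEq σ]

/-- On the affine chart `h i = 1`, the remaining members of a homogeneous system of parameters have
finitely many common zeros. -/
theorem finite_commonZeros (hh : ∀ i, (h i).IsHomogeneous (e i)) (he : ∀ i, 1 ≤ e i)
    (hsop : ∀ x, (∀ i, eval x (h i) = 0) → x = 0) (i : σ) :
    {x : σ → K | (∀ j ≠ i, eval x (h j) = 0) ∧ eval x (h i) = 1}.Finite := by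
  obtain ⟨D, hD⟩ := Ideal.exists_pow_le_of_le_radical_of_fg (idealOfVars_le_radical hsop)
    (idealOfVars_fg σ K)
  set I := Ideal.span (h '' ↑(Finset.univ.erase i)) with hI
  have hIhom : I.IsHomogeneous (homogeneousSubmodule σ K) := isHomogeneous_span hh _
  set J := I ⊔ Ideal.span {h i - 1} with hJ
  have hhom : ∀ n, ∀ p : MvPolynomial σ K, p.IsHomogeneous n →
      ∃ q ∈ restrictTotalDegree σ K D, p - q ∈ J := by
    intro n
    induction n using Nat.strong_induction_on with
    | _ n ih =>
      intro p hp
      rcases lt_or_ge n D with hn | hn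
      · exact ⟨p, (mem_restrictTotalDegree _ _ _).2 (hp.totalDegree_le.trans hn.le), by simp⟩
      have hpI : p ∈ I ⊔ Ideal.span {h i} := by
        rw [← span_range_eq_sup]
        exact hD (IsHomogeneous.mem_idealOfVars_pow hp hn)
      rcases exists_homogeneous_of_mem_sup hIhom (hh i) hp hpI with hmem | ⟨c, k, hc, hk, hpc⟩
      · exact ⟨0, Submodule.zero_mem _, by simpa using Ideal.mem_sup_left hmem⟩
      · obtain ⟨q, hq, hcq⟩ := ih k (by have := he i; omega) c hc
        refine ⟨q, hq, ?_⟩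
        have h1 : c * (h i - 1) ∈ J := Ideal.mem_sup_right
          (Ideal.mul_mem_left _ _ (Ideal.mem_span_singleton_self _))
        convert J.add_mem (J.add_mem (Ideal.mem_sup_left hpc) h1) hcq using 1
        ring
  have hfin : Module.Finite K (MvPolynomial σ K ⧸ J) := by
    refine Module.Finite.of_surjective
      ((Ideal.Quotient.mkₐ K J).toLinearMap ∘ₗ (restrictTotalDegree σ K D).subtype) fun z => ?_
    obtain ⟨p, rfl⟩ := Ideal.Quotient.mk_surjective z
    choose q hq hpq using fun n =>
      hhom n (homogeneousComponent n p) (homogeneousComponent_isHomogeneous n p)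
    refine ⟨⟨∑ n ∈ Finset.range (p.totalDegree + 1), q n, Submodule.sum_mem _ fun n _ => hq n⟩, ?_⟩
    refine (Ideal.Quotient.eq.2 ?_).symm
    change p - ∑ n ∈ Finset.range (p.totalDegree + 1), q n ∈ J
    nth_rewrite 1 [← sum_homogeneousComponent p]
    rw [← Finset.sum_sub_distrib]
    exact Ideal.sum_mem _ fun n _ => hpq n
  have hker : ∀ x : {x : σ → K | (∀ j ≠ i, eval x (h j) = 0) ∧ eval x (h i) = 1},
      ∀ p ∈ J, aeval x.1 p = 0 := by
    rintro ⟨x, hx0, hx1⟩ p hp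
    have : J ≤ RingHom.ker (aeval x : MvPolynomial σ K →ₐ[K] K) := by
      refine sup_le (Ideal.span_le.2 ?_) (Ideal.span_le.2 ?_)
      · rintro _ ⟨j, hj, rfl⟩
        simpa [aeval_eq_eval] using hx0 j (by simpa using hj)
      · simp [aeval_eq_eval, hx1]
    exact this hp
  refine Set.finite_coe_iff.1 (Finite.of_injective (β := (MvPolynomial σ K ⧸ J) →ₐ[K] K)
    (fun x => Ideal.Quotient.liftₐ J (aeval x.1) (hker x)) fun x y hxy => Subtype.ext ?_)
  ext j
  simpa using congrArg (fun φ => φ (Ideal.Quotient.mk J (X j))) hxy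

/-- Any member of a homogeneous system of parameters can be replaced by a linear form. -/
theorem exists_linear_update (hh : ∀ i, (h i).IsHomogeneous (e i)) (he : ∀ i, 1 ≤ e i)
    (hsop : ∀ x, (∀ i, eval x (h i) = 0) → x = 0) (i : σ) :
    ∃ y : MvPolynomial σ K, y.IsHomogeneous 1 ∧
      ∀ x, (∀ j, eval x (Function.update h i y j) = 0) → x = 0 := by
  have hfin := (finite_commonZeros hh he hsop i).to_subtype
  have := IsAlgClosed.instInfinite (K := K)
  obtain ⟨f, hf⟩ := Module.exists_dual_forall_apply_ne_zero (K := K)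
    (fun x : {x : σ → K | (∀ j ≠ i, eval x (h j) = 0) ∧ eval x (h i) = 1} => x.1) (by
      rintro ⟨x, -, hx⟩ (rfl : x = 0)
      have h0 := IsHomogeneous.eval_smul (hh i) 0 (0 : σ → K)
      rw [zero_pow (by have := he i; omega), smul_zero, zero_mul, hx] at h0
      exact one_ne_zero h0)
  have hy : ∀ x, eval x (∑ j, C (f (Pi.single j 1)) * X j) = f x := fun x => by
    have hsingle : ∀ j, (Pi.single j 1 : σ → K) = fun k => if j = k then 1 else 0 := fun j => by
      ext k
      simp [Pi.single_apply, eq_comm]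
    rw [LinearMap.pi_apply_eq_sum_univ f x]
    simp [hsingle, mul_comm]
  refine ⟨∑ j, C (f (Pi.single j 1)) * X j,
    IsHomogeneous.sum _ _ _ fun j _ => isHomogeneous_C_mul_X _ _, fun x hx => ?_⟩
  have hxj : ∀ j ≠ i, eval x (h j) = 0 := fun j hj => by
    simpa [Function.update_of_ne hj] using hx j
  have hfx : f x = 0 := by
    have := hx i
    rwa [Function.update_self, hy] at this
  by_cases hxi : eval x (h i) = 0
  · refine hsop x fun j => ?_
    by_cases hj : j = i
    · rwa [hj]
    · exact hxj j hj
  · obtain ⟨c, hc⟩ := IsAlgClosed.exists_pow_nat_eq (eval x (h i))⁻¹ (n := e i) (he i)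
    refine (hf ⟨c • x, fun j hj => ?_, ?_⟩ ?_).elim
    · rw [IsHomogeneous.eval_smul (hh j), hxj j hj, mul_zero]
    · rw [IsHomogeneous.eval_smul (hh i), hc, inv_mul_cancel₀ hxi]
    · simp [hfx]

/-- A homogeneous system of parameters in a polynomial ring is a regular sequence, and its quotient
is Gorenstein. -/
theorem stronglyRegular_and_nondegenerate (hh : ∀ i, (h i).IsHomogeneous (e i))
    (he : ∀ i, 1 ≤ e i) (hsop : ∀ x, (∀ i, eval x (h i) = 0) → x = 0) :
    StronglyRegular h ∧ Nondegenerate (Ideal.span (Set.range h)) (∑ i, (e i - 1)) := by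
  induction hs : ({i | e i ≠ 1} : Finset σ) using Finset.induction_on generalizing h e with
  | empty =>
    have he1 : ∀ i, e i = 1 := fun i => by
      by_contra hi
      have : i ∈ ({i | e i ≠ 1} : Finset σ) := by simpa using hi
      simp [hs] at this
    have hh1 : ∀ i, (h i).IsHomogeneous 1 := fun i => he1 i ▸ hh i
    exact ⟨stronglyRegular_of_linear hh1 hsop, by
      simpa [he1] using nondegenerate_of_linear hh1 hsop⟩
  | insert i s his ih =>
    obtain ⟨y, hy, hysop⟩ := exists_linear_update hh he hsop i
    have hh' : ∀ j, (Function.update h i y j).IsHomogeneous (Function.update e i 1 j) := by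
      intro j
      by_cases hj : j = i
      · subst hj; simpa using hy
      · simpa [Function.update_of_ne hj] using hh j
    have he' : ∀ j, 1 ≤ Function.update e i 1 j := by
      intro j
      by_cases hj : j = i
      · subst hj; simp
      · simpa [Function.update_of_ne hj] using he j
    obtain ⟨hreg, hnd⟩ := ih hh' he' hysop (by
      ext j
      by_cases hj : j = i
      · subst hj; simpa using his
      · simpa [Function.update_of_ne hj, hj] using Finset.ext_iff.1 hs j)
    have hni := Finset.notMem_erase i Finset.univ
    have hyreg := hreg _ i hni
    rw [span_range_eq_sup _ i] at hnd
    rw [image_update_of_notMem _ _ hni, Function.update_self] at hyreg hnd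
    have hyrad : y ∈ (Ideal.span (h '' ↑(Finset.univ.erase i)) ⊔ Ideal.span {h i}).radical := by
      rw [← span_range_eq_sup]
      exact idealOfVars_le_radical hsop
        (by simpa using IsHomogeneous.mem_idealOfVars_pow (D := 1) hy le_rfl)
    obtain ⟨hireg, hind⟩ := hnd.exchange (isHomogeneous_span hh _) hy hyreg (hh i) hyrad
    refine ⟨?_, ?_⟩
    · have := hreg.update hh' he' (i := i) (g := h i)
        (by rwa [image_update_of_notMem _ _ hni])
      simpa using this
    · rw [← span_range_eq_sup] at hind
      convert hind using 1
      rw [← Finset.add_sum_erase _ _ (Finset.mem_univ i),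
        ← Finset.add_sum_erase _ (fun j => Function.update e i 1 j - 1) (Finset.mem_univ i),
        Finset.sum_congr rfl fun j hj => by
          rw [← Function.update_of_ne (Finset.ne_of_mem_erase hj) 1 e]]
      have := he i
      simp only [Function.update_self]
      omega

end Parameters

end GradedDuality

theorem jacobian_ring_gorenstein_pairing (n d : ℕ) (hn : 1 ≤ n) (hd : 2 ≤ d)
    (f : MvPolynomial (Fin (n + 2)) ℂ) (hf : f.IsHomogeneous d)
    (hsm : ∀ x : Fin (n + 2) → ℂ, (∀ i, eval x (pderiv i f) = 0) → x = 0) :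
    ∀ ℓ : ℕ, ℓ ≤ (n + 2) * (d - 2) →
      ∀ a ∈ jacPiece n f ℓ, a ≠ 0 →
        ∃ b ∈ jacPiece n f ((n + 2) * (d - 2) - ℓ), a * b ≠ 0 := by
  intro ℓ _ a ha ha0
  obtain ⟨p, hp, rfl⟩ := ha
  have hnd := (GradedDuality.stronglyRegular_and_nondegenerate (h := fun i => pderiv i f)
    (e := fun _ => d - 1) (fun _ => hf.pderiv) (fun _ => by omega) hsm).2
  obtain ⟨k, q, hq, hk, hpq⟩ := hnd ℓ p hp fun hmem =>
    ha0 (Ideal.Quotient.eq_zero_iff_mem.2 hmem)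
  have hσ : ℓ + k = (n + 2) * (d - 2) := by
    simpa [Nat.sub_sub] using hk
  refine ⟨Ideal.Quotient.mk _ q, ⟨q, ?_, rfl⟩, fun hzero => hpq ?_⟩
  · rw [← hσ, Nat.add_sub_cancel_left]
    exact hq
  · exact Ideal.Quotient.eq_zero_iff_mem.1 ((map_mul _ p q).trans hzero)
end

section
/- (Graded Mather–Yau, as used in Corollary 3.14 of the paper.) If there exists an isomorphism of graded ℂ-algebras J(f) ≅ J(g) (i.e. a ℂ-algebra isomorphism carrying J(f)_ℓ onto J(g)_ℓ for every ℓ), then the hypersurfaces V(f) and V(g) in ℙ^{n+1} are isomorphic; more precisely, there exist an invertible matrix A ∈ GL(n+2, ℂ) and a nonzero scalar c ∈ ℂ such that substituting the linear forms determined by A for the variables transforms f into c·g. -/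
open MvPolynomial

section LinearSubstitution

open Matrix

variable {σ K : Type*} [Field K]

theorem pderiv_pderiv_comm (i j : σ) (p : MvPolynomial σ K) :
    pderiv i (pderiv j p) = pderiv j (pderiv i p) := by
  classical
  have : ⁅(pderiv i : Derivation K (MvPolynomial σ K) (MvPolynomial σ K)),
      (pderiv j : Derivation K (MvPolynomial σ K) (MvPolynomial σ K))⁆ = 0 := by
    ext1 k
    simp [Derivation.commutator_apply, pderiv_X, Pi.single_apply, apply_ite]
  have h := DFunLike.congr_fun this p
  rwa [Derivation.commutator_apply, Derivation.zero_apply, sub_eq_zero] at h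

/-- The Hessian matrix of a polynomial. -/
noncomputable def hessian (p : MvPolynomial σ K) : Matrix σ σ (MvPolynomial σ K) :=
  Matrix.of fun i j => pderiv i (pderiv j p)

variable [Fintype σ]

/-- The substitution `X i ↦ ∑ j, A i j X j` of linear forms for the variables. -/
noncomputable def linSubst (A : Matrix σ σ K) : MvPolynomial σ K →ₐ[K] MvPolynomial σ K :=
  aeval fun i => ∑ j, C (A i j) * X j

theorem linSubst_X (A : Matrix σ σ K) (i : σ) :
    linSubst A (X i) = ∑ j, C (A i j) * X j := by
  simp [linSubst]

theorem linSubst_linSubst (A B : Matrix σ σ K) (p : MvPolynomial σ K) :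
    linSubst B (linSubst A p) = linSubst (A * B) p := by
  have : (linSubst B).comp (linSubst A) = linSubst (A * B) := by
    ext1 i
    simp only [AlgHom.comp_apply, linSubst_X, map_sum, map_mul, ← algebraMap_eq,
      AlgHom.commutes, Matrix.mul_apply, Finset.mul_sum, Finset.sum_mul, mul_assoc]
    exact Finset.sum_comm
  exact DFunLike.congr_fun this p

theorem linSubst_isHomogeneous (A : Matrix σ σ K) {p : MvPolynomial σ K} {d : ℕ}
    (hp : p.IsHomogeneous d) : (linSubst A p).IsHomogeneous d := by
  have := hp.aeval (fun i => ∑ j, C (A i j) * X j) (n := 1)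
    fun i => IsHomogeneous.sum _ _ _ fun j _ => isHomogeneous_C_mul_X _ _
  rwa [one_mul] at this

/-- A form of degree at most `m` in an ideal generated by forms of degree `m` is a linear
combination of the generators, and vanishes if its degree is smaller than `m`. -/
theorem exists_eq_sum_C_mul_of_mem_span {u : σ → MvPolynomial σ K} {m k : ℕ}
    (hu : ∀ i, (u i).IsHomogeneous m) {p : MvPolynomial σ K} (hp : p.IsHomogeneous k)
    (hmem : p ∈ Ideal.span (Set.range u)) (hk : k ≤ m) :
    ∃ c : σ → K, p = ∑ i, C (c i) * u i ∧ (k < m → p = 0) := by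
  obtain ⟨a, ha⟩ := Ideal.mem_span_range_iff_exists_fun.1 hmem
  have hcomp : ∀ q i, homogeneousComponent k (q * u i) =
      if m ≤ k then homogeneousComponent (k - m) q * u i else 0 := by
    intro q i
    let _ : GradedAlgebra (homogeneousSubmodule σ K) := gradedAlgebra
    rw [← decomposition.decompose'_apply, ← decomposition.decompose'_apply]
    split_ifs with h
    · exact DirectSum.coe_decompose_mul_of_right_mem_of_le (homogeneousSubmodule σ K)
        (a := q) (hu i) h
    · exact DirectSum.coe_decompose_mul_of_right_mem_of_not_le (homogeneousSubmodule σ K)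
        (a := q) (hu i) h
  have hpk : p = homogeneousComponent k p := (homogeneousComponent_eq_self hp).symm
  rw [← ha, map_sum] at hpk
  simp only [hcomp, ha] at hpk
  rcases hk.lt_or_eq with h | rfl
  · have : p = 0 := by simpa [h.not_ge] using hpk
    exact ⟨0, by simp [this], fun _ => this⟩
  · refine ⟨fun i => coeff 0 (a i), ?_, fun h => (lt_irrefl _ h).elim⟩
    simpa using hpk

/-- The partial derivatives of a homogeneous polynomial of degree at least two with no nonzero
singular point are linearly independent. -/
theorem eq_zero_of_sum_C_mul_pderiv_eq_zero [CharZero K] {p : MvPolynomial σ K} {d : ℕ}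
    (hd : 2 ≤ d) (hp : p.IsHomogeneous d)
    (hsm : ∀ x : σ → K, (∀ i, eval x (pderiv i p) = 0) → x = 0)
    {c : σ → K} (hc : ∑ i, C (c i) * pderiv i p = 0) : c = 0 := by
  refine hsm c fun j => ?_
  have h1 := congrArg (eval c) (congrArg (pderiv j) hc)
  have h2 := congrArg (eval c) (hp.pderiv (i := j)).sum_X_mul_pderiv
  simp only [map_sum, pderiv_C_mul, map_mul, eval_C, map_zero] at h1
  simp only [map_sum, map_mul, eval_X, nsmul_eq_mul, map_natCast,
    pderiv_pderiv_comm _ j, h1] at h2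
  have h3 : ((d - 1 : ℕ) : K) ≠ 0 := by
    have : d - 1 ≠ 0 := by omega
    exact_mod_cast this
  exact (mul_eq_zero.1 h2.symm).resolve_left h3

variable [DecidableEq σ]

theorem linSubst_one (p : MvPolynomial σ K) : linSubst (1 : Matrix σ σ K) p = p := by
  have : linSubst (1 : Matrix σ σ K) = AlgHom.id K _ := by
    ext1 i
    simp [linSubst_X, Matrix.one_apply, apply_ite C]
  exact DFunLike.congr_fun this p

theorem linSubst_injective {A : Matrix σ σ K} (hA : IsUnit A) :
    Function.Injective (linSubst A) := by
  intro p q h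
  have h' := congrArg (linSubst A⁻¹) h
  rwa [linSubst_linSubst, linSubst_linSubst,
    A.mul_nonsing_inv ((A.isUnit_iff_isUnit_det).1 hA), linSubst_one, linSubst_one] at h'

theorem pderiv_linSubst (A : Matrix σ σ K) (j : σ) (p : MvPolynomial σ K) :
    pderiv j (linSubst A p) = ∑ i, C (A i j) * linSubst A (pderiv i p) := by
  induction p using MvPolynomial.induction_on with
  | C a => simp [linSubst]
  | add p q hp hq => simp [hp, hq, mul_add, Finset.sum_add_distrib]
  | mul_X p k hp =>
    simp only [map_mul, pderiv_mul, hp, map_add, mul_add, Finset.sum_add_distrib, Finset.sum_mul]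
    congr 1
    · exact Finset.sum_congr rfl fun i _ => by ring
    · simp [linSubst_X, pderiv_X, Pi.single_apply, apply_ite, mul_comm]

/-- If `N` is self-adjoint for the Hessian of a homogeneous polynomial `p`, then substituting
`Nᵀ` into the gradient of `p` amounts to multiplying the gradient by a power of `N`. -/
theorem linSubst_transpose_pderiv [CharZero K] {N : Matrix σ σ K} {e : ℕ} :
    ∀ {p : MvPolynomial σ K}, p.IsHomogeneous (e + 1) →
      SemiconjBy (hessian p) ((C (σ := σ)).mapMatrix N)ᵀ ((C (σ := σ)).mapMatrix N) →
      (fun i => linSubst Nᵀ (pderiv i p)) =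
        (C (σ := σ)).mapMatrix N ^ e *ᵥ fun i => pderiv i p := by
  induction e with
  | zero =>
    intro p hp _
    funext i
    have h0 : (pderiv i p).totalDegree = 0 :=
      (totalDegree_zero_iff_isHomogeneous σ).2 hp.pderiv
    obtain ⟨c, hc⟩ : ∃ c, pderiv i p = C c := ⟨_, totalDegree_eq_zero_iff_eq_C.1 h0⟩
    simp [linSubst, hc]
  | succ e ih =>
    intro p hp hN
    set N' := (C (σ := σ)).mapMatrix N with hN'
    funext k
    have hk : SemiconjBy (hessian (pderiv k p)) N'ᵀ N' := by
      have hess : hessian (pderiv k p) = (hessian p).map (pderiv k) := by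
        ext1 i j
        simp only [hessian, Matrix.of_apply, Matrix.map_apply]
        rw [pderiv_pderiv_comm j k, pderiv_pderiv_comm i k]
      rw [SemiconjBy, hess]
      ext1 i j
      have h := congrArg (pderiv k) (congrFun (congrFun hN.eq i) j)
      simpa [Matrix.mul_apply, hN', pderiv_mul, mul_comm] using h
    have hX : (fun i => linSubst Nᵀ (X i)) = X ᵥ* N' := by
      funext i
      simp [linSubst_X, Matrix.vecMul, dotProduct, hN', mul_comm]
    have euler : (X ᵥ* hessian p) = (e + 1 : MvPolynomial σ K) • fun i => pderiv i p := by
      funext i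
      have h := (hp.pderiv (i := i)).sum_X_mul_pderiv
      simpa [Matrix.vecMul, dotProduct, hessian] using h
    have key := congrArg (linSubst Nᵀ) (hp.pderiv (i := k)).sum_X_mul_pderiv
    have e0 : (e + 1 : MvPolynomial σ K) ≠ 0 := by exact_mod_cast e.succ_ne_zero
    refine mul_left_cancel₀ e0 ?_
    calc (e + 1 : MvPolynomial σ K) * linSubst Nᵀ (pderiv k p)
        = (fun i => linSubst Nᵀ (X i)) ⬝ᵥ fun i => linSubst Nᵀ (pderiv i (pderiv k p)) := by
          simpa [dotProduct] using key.symm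
      _ = (X ᵥ* (N' ^ (e + 1) * hessian p)) k := by
          rw [ih hp.pderiv hk, hX, ← dotProduct_mulVec, mulVec_mulVec, ← pow_succ']
          rw [← vecMul_vecMul, dotProduct_mulVec]
          rfl
      _ = (X ᵥ* (hessian p * (N' ^ (e + 1))ᵀ)) k := by
          rw [transpose_pow, (hN.pow_right (e + 1)).eq]
      _ = (e + 1) * (N' ^ (e + 1) *ᵥ fun i => pderiv i p) k := by
          rw [← vecMul_vecMul, vecMul_transpose, euler, mulVec_smul]
          rfl

/-- A matrix `N` relating the gradients of `h` and `g` is self-adjoint for the Hessian of `g`. -/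
theorem semiconjBy_hessian {N : Matrix σ σ K} {g h : MvPolynomial σ K}
    (hN : ∀ i, pderiv i h = ∑ k, C (N i k) * pderiv k g) :
    SemiconjBy (hessian g) ((C (σ := σ)).mapMatrix N)ᵀ ((C (σ := σ)).mapMatrix N) := by
  ext1 i j
  have h1 := pderiv_pderiv_comm i j h
  rw [hN i, hN j] at h1
  simp only [map_sum, pderiv_C_mul] at h1
  simp only [hessian, Matrix.mul_apply, Matrix.transpose_apply, RingHom.mapMatrix_apply,
    Matrix.map_apply, Matrix.of_apply]
  rw [Finset.sum_congr rfl fun k _ => mul_comm _ _, h1]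
  exact Finset.sum_congr rfl fun k _ => by rw [pderiv_pderiv_comm]

theorem semiconjBy_aeval {N : Matrix σ σ K} {H : Matrix σ σ (MvPolynomial σ K)}
    (hN : SemiconjBy H ((C (σ := σ)).mapMatrix N)ᵀ ((C (σ := σ)).mapMatrix N))
    (P : Polynomial K) :
    SemiconjBy H ((C (σ := σ)).mapMatrix (Polynomial.aeval N P))ᵀ
      ((C (σ := σ)).mapMatrix (Polynomial.aeval N P)) := by
  induction P using Polynomial.induction_on' with
  | add P Q hP hQ =>
    rw [map_add, map_add, transpose_add]
    exact hP.add_right hQ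
  | monomial m a =>
    have h : (C (σ := σ)).mapMatrix (Polynomial.aeval N (Polynomial.monomial m a)) =
        (C a : MvPolynomial σ K) • (C (σ := σ)).mapMatrix N ^ m := by
      rw [Polynomial.aeval_monomial, map_mul, map_pow, Matrix.algebraMap_eq_diagonal]
      ext1 i j
      simp [Matrix.diagonal_map]
    rw [h, transpose_smul, transpose_pow, SemiconjBy, Matrix.mul_smul, Matrix.smul_mul,
      (hN.pow_right m).eq]

/-- An invertible matrix over an algebraically closed field of characteristic zero has a `d`-th
root which is a polynomial in it. -/
theorem exists_aeval_pow_eq [CharZero K] [IsAlgClosed K] {N : Matrix σ σ K} (hN : IsUnit N)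
    {d : ℕ} (hd : d ≠ 0) : ∃ P : Polynomial K, Polynomial.aeval N P ^ d = N := by
  classical
  set q := N.charpoly with hq
  have hq0 : q ≠ 0 := N.charpoly_monic.ne_zero
  have hroot : ∀ a ∈ q.roots, a ≠ 0 := by
    rintro a ha rfl
    have h0 : q.coeff 0 = 0 := by
      rw [Polynomial.coeff_zero_eq_eval_zero]; exact (Polynomial.mem_roots hq0).1 ha
    refine ((Matrix.isUnit_iff_isUnit_det N).1 hN).ne_zero ?_
    rw [Matrix.det_eq_sign_charpoly_coeff, ← hq, h0, mul_zero]
  choose r hr using fun a : K => IsAlgClosed.exists_pow_nat_eq a (Nat.pos_of_ne_zero hd)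
  set P₀ := Lagrange.interpolate q.roots.toFinset id r with hP₀
  have hP₀r : ∀ a ∈ q.roots, P₀.eval a = r a := fun a ha =>
    Lagrange.eval_interpolate_at_node r (Set.injOn_id _) (Multiset.mem_toFinset.2 ha)
  have hdvd : ∀ Q : Polynomial K, (∀ a ∈ q.roots, Q.eval a = 0) →
      IsNilpotent (AdjoinRoot.mk q Q) := by
    intro Q hQ
    refine ⟨Multiset.card q.roots, ?_⟩
    rw [← map_pow, AdjoinRoot.mk_eq_zero,
      (IsAlgClosed.splits q).eq_prod_roots_of_monic N.charpoly_monic]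
    have := Multiset.prod_dvd_prod_of_dvd (S := q.roots) (fun a => Polynomial.X - Polynomial.C a)
      (fun _ => Q) fun a ha => Polynomial.dvd_iff_isRoot.2 (hQ a ha)
    simpa using this
  have hunit : ∀ Q : Polynomial K, (∀ a ∈ q.roots, Q.eval a ≠ 0) →
      IsUnit (AdjoinRoot.mk q Q) := by
    intro Q hQ
    have hcop : IsCoprime Q q := by
      refine isCoprime_of_irreducible_dvd (fun h => hq0 h.2) fun z hz hzQ hzq => ?_
      obtain ⟨a, ha⟩ := IsAlgClosed.exists_root z (Polynomial.degree_pos_of_irreducible hz).ne'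
      exact hQ a ((Polynomial.mem_roots hq0).2 (ha.dvd hzq)) (ha.dvd hzQ)
    obtain ⟨u, v, huv⟩ := hcop
    refine IsUnit.of_mul_eq_one_right (AdjoinRoot.mk q u) ?_
    have := congrArg (AdjoinRoot.mk q) huv
    simpa using this
  obtain ⟨s, ⟨-, hs⟩, -⟩ := Polynomial.existsUnique_nilpotent_sub_and_aeval_eq_zero
    (R := AdjoinRoot q) (S := AdjoinRoot q) (x := AdjoinRoot.mk q P₀)
    (P := Polynomial.X ^ d - Polynomial.C (AdjoinRoot.mk q Polynomial.X))
    (by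
      have := hdvd (P₀ ^ d - Polynomial.X) fun a ha => by simp [hP₀r a ha, hr]
      simpa using this)
    (by
      have := hunit (Polynomial.C (d : K) * P₀ ^ (d - 1)) fun a ha => by
        have : r a ≠ 0 := fun h => hroot a ha (by rw [← hr a, h, zero_pow hd])
        simp [hP₀r a ha, hd, this]
      simpa [Polynomial.derivative_X_pow] using this)
  obtain ⟨P, rfl⟩ := AdjoinRoot.mk_surjective s
  refine ⟨P, ?_⟩
  have h1 : AdjoinRoot.mk q (P ^ d - Polynomial.X) = 0 := by simpa using hs
  obtain ⟨w, hw⟩ := AdjoinRoot.mk_eq_zero.1 h1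
  have h2 := congrArg (Polynomial.aeval N) hw
  rw [map_mul, hq, Matrix.aeval_self_charpoly, zero_mul] at h2
  simpa [sub_eq_zero] using h2

/-- If an invertible matrix carries the gradient of `g` to the gradient of `h`, then `h` is obtained
from `g` by an invertible linear substitution. -/
theorem exists_linSubst_eq_of_pderiv [CharZero K] [IsAlgClosed K] {N : Matrix σ σ K}
    (hNu : IsUnit N) {d : ℕ} (hd : d ≠ 0) {g h : MvPolynomial σ K}
    (hg : g.IsHomogeneous d) (hh : h.IsHomogeneous d)
    (hN : ∀ i, pderiv i h = ∑ k, C (N i k) * pderiv k g) :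
    ∃ B : Matrix σ σ K, IsUnit B ∧ linSubst B g = h := by
  obtain ⟨P, hP⟩ := exists_aeval_pow_eq hNu hd
  set M := Polynomial.aeval N P with hM
  have hMu : IsUnit M := (isUnit_pow_iff hd).1 (hP ▸ hNu)
  obtain ⟨e, rfl⟩ := Nat.exists_eq_succ_of_ne_zero hd
  refine ⟨Mᵀ, (Matrix.isUnit_transpose M).2 hMu, ?_⟩
  have hgrad := linSubst_transpose_pderiv hg (semiconjBy_aeval (semiconjBy_hessian hN) P)
  rw [← hM] at hgrad
  have hX : (fun i => linSubst Mᵀ (X i)) = X ᵥ* (C (σ := σ)).mapMatrix M := by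
    funext i
    simp [linSubst_X, Matrix.vecMul, dotProduct, mul_comm]
  have e0 : ((e + 1 : ℕ) : MvPolynomial σ K) ≠ 0 := by exact_mod_cast e.succ_ne_zero
  refine mul_left_cancel₀ e0 ?_
  calc ((e + 1 : ℕ) : MvPolynomial σ K) * linSubst Mᵀ g
      = (fun i => linSubst Mᵀ (X i)) ⬝ᵥ fun i => linSubst Mᵀ (pderiv i g) := by
        simpa [dotProduct] using (congrArg (linSubst Mᵀ) hg.sum_X_mul_pderiv).symm
    _ = X ⬝ᵥ ((C (σ := σ)).mapMatrix N *ᵥ fun i => pderiv i g) := by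
        rw [hgrad, hX, ← dotProduct_mulVec, mulVec_mulVec, ← pow_succ', ← map_pow, hP]
    _ = ((e + 1 : ℕ) : MvPolynomial σ K) * h := by
        have h1 := hh.sum_X_mul_pderiv
        simp only [hN] at h1
        simpa [dotProduct, Matrix.mulVec] using h1

theorem isUnit_of_vecMul_eq_zero {N : Matrix σ σ K} (h : ∀ c, c ᵥ* N = 0 → c = 0) : IsUnit N := by
  rw [← Matrix.vecMul_injective_iff_isUnit]
  exact (injective_iff_map_eq_zero (Matrix.vecMulLinear N)).2 h

end LinearSubstitution

/-- Graded Mather–Yau: a graded isomorphism of Jacobian rings implies the hypersurfaces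
are related by a linear change of coordinates (up to scaling the equation). -/
theorem graded_mather_yau (n d : ℕ) (hn : 1 ≤ n) (hd : 3 ≤ d)
    (f g : MvPolynomial (Fin (n + 2)) ℂ)
    (hf : f.IsHomogeneous d) (hg : g.IsHomogeneous d)
    (hsmf : ∀ x : Fin (n + 2) → ℂ, (∀ i, eval x (pderiv i f) = 0) → x = 0)
    (hsmg : ∀ x : Fin (n + 2) → ℂ, (∀ i, eval x (pderiv i g) = 0) → x = 0)
    (hiso : ∃ e : (MvPolynomial (Fin (n + 2)) ℂ ⧸ jacIdeal n f) ≃ₐ[ℂ]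
        (MvPolynomial (Fin (n + 2)) ℂ ⧸ jacIdeal n g),
      ∀ ℓ : ℕ, (jacPiece n f ℓ).map e.toLinearMap = jacPiece n g ℓ) :
    ∃ (A : Matrix (Fin (n + 2)) (Fin (n + 2)) ℂ) (c : ℂ), IsUnit A ∧ c ≠ 0 ∧
      aeval (fun i : Fin (n + 2) => ∑ j : Fin (n + 2), C (A i j) * X j) f = C c * g := by
  obtain ⟨e, he⟩ := hiso
  have hlift : ∀ i, ∃ a : Fin (n + 2) → ℂ,
      Ideal.Quotient.mkₐ ℂ (jacIdeal n g) (∑ j, C (a j) * X j) =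
        e (Ideal.Quotient.mkₐ ℂ (jacIdeal n f) (X i)) := by
    intro i
    have hi : e (Ideal.Quotient.mkₐ ℂ (jacIdeal n f) (X i)) ∈ jacPiece n g 1 := by
      rw [← he 1]
      exact Submodule.mem_map_of_mem (Submodule.mem_map_of_mem (isHomogeneous_X ℂ i))
    obtain ⟨l, hl, hl'⟩ := Submodule.mem_map.1 hi
    rw [homogeneousSubmodule_one_eq_span_X] at hl
    obtain ⟨a, rfl⟩ := (Submodule.mem_span_range_iff_exists_fun ℂ).1 hl
    refine ⟨a, ?_⟩
    simp only [smul_eq_C_mul] at hl'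
    exact hl'
  choose A hA using hlift
  have hcomm : ∀ p, Ideal.Quotient.mkₐ ℂ (jacIdeal n g) (linSubst (Matrix.of A) p) =
      e (Ideal.Quotient.mkₐ ℂ (jacIdeal n f) p) := by
    have : (Ideal.Quotient.mkₐ ℂ (jacIdeal n g)).comp (linSubst (Matrix.of A)) =
        e.toAlgHom.comp (Ideal.Quotient.mkₐ ℂ (jacIdeal n f)) := by
      ext1 i
      rw [AlgHom.comp_apply, linSubst_X]
      exact hA i
    exact DFunLike.congr_fun this
  have hmem : ∀ p, linSubst (Matrix.of A) p ∈ jacIdeal n g ↔ p ∈ jacIdeal n f := by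
    intro p
    rw [← Ideal.Quotient.eq_zero_iff_mem, ← Ideal.Quotient.eq_zero_iff_mem]
    have h := hcomm p
    simp only [Ideal.Quotient.mkₐ_eq_mk] at h
    rw [h, map_eq_zero_iff e e.injective]
  have hAu : IsUnit (Matrix.of A) := by
    refine isUnit_of_vecMul_eq_zero fun c hc => ?_
    have h0 : linSubst (Matrix.of A) (∑ i, C (c i) * X i) = 0 := by
      have h1 : linSubst (Matrix.of A) (∑ i, C (c i) * X i) =
          ∑ j, C ((Matrix.vecMul c (Matrix.of A)) j) * X j := by
        simp only [map_sum, map_mul, linSubst_X, ← algebraMap_eq, AlgHom.commutes,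
          Matrix.vecMul, dotProduct, Finset.mul_sum, Finset.sum_mul, mul_assoc]
        exact Finset.sum_comm
      simp [h1, hc]
    obtain ⟨_, -, h2⟩ := exists_eq_sum_C_mul_of_mem_span (fun i => hf.pderiv)
      (IsHomogeneous.sum _ _ 1 fun j _ => isHomogeneous_C_mul_X (c j) j)
      ((hmem _).1 (h0 ▸ zero_mem _)) (by omega : 1 ≤ d - 1)
    have h3 := h2 (by omega)
    funext i
    have h4 := congrArg (pderiv i) h3
    simpa [pderiv_X, Pi.single_apply] using h4
  have hspan : ∀ j, ∃ c : Fin (n + 2) → ℂ,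
      pderiv j (linSubst (Matrix.of A) f) = ∑ k, C (c k) * pderiv k g := by
    intro j
    obtain ⟨c, hc, -⟩ := exists_eq_sum_C_mul_of_mem_span (u := fun i => pderiv i g)
      (fun i => hg.pderiv) (linSubst_isHomogeneous (Matrix.of A) hf).pderiv
      (p := pderiv j (linSubst (Matrix.of A) f)) (by
        rw [pderiv_linSubst]
        exact Ideal.sum_mem _ fun i _ => Ideal.mul_mem_left _ _
          ((hmem _).2 (Ideal.subset_span ⟨i, rfl⟩))) le_rfl
    exact ⟨c, hc⟩
  choose N hN using hspan
  have hNu : IsUnit (Matrix.of N) := by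
    refine isUnit_of_vecMul_eq_zero fun c hc => ?_
    have h1 : ∑ j, C (c j) * pderiv j (linSubst (Matrix.of A) f) = 0 := by
      have h2 : ∑ j, C (c j) * pderiv j (linSubst (Matrix.of A) f) =
          ∑ k, C ((Matrix.vecMul c (Matrix.of N)) k) * pderiv k g := by
        simp only [hN, Matrix.vecMul, dotProduct, Finset.mul_sum, map_sum, map_mul,
          Finset.sum_mul, mul_assoc]
        exact Finset.sum_comm
      simp [h2, hc]
    have h3 : linSubst (Matrix.of A)
        (∑ i, C (Matrix.mulVec (Matrix.of A) c i) * pderiv i f) = 0 := by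
      rw [← h1]
      simp only [pderiv_linSubst, map_sum, map_mul, ← algebraMap_eq, AlgHom.commutes,
        Matrix.mulVec, dotProduct, Finset.mul_sum, Finset.sum_mul]
      rw [Finset.sum_comm]
      exact Finset.sum_congr rfl fun _ _ => Finset.sum_congr rfl fun _ _ => by ring
    have h4 := eq_zero_of_sum_C_mul_pderiv_eq_zero (by omega) hf hsmf
      (linSubst_injective hAu (h3.trans (map_zero _).symm))
    exact Matrix.mulVec_injective_iff_isUnit.2 hAu (h4.trans (Matrix.mulVec_zero _).symm)
  obtain ⟨B, hBu, hB⟩ := exists_linSubst_eq_of_pderiv hNu (by omega) hg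
    (linSubst_isHomogeneous (Matrix.of A) hf) hN
  refine ⟨Matrix.of A * B⁻¹, 1, hAu.mul (Matrix.isUnit_nonsing_inv_iff.2 hBu), one_ne_zero, ?_⟩
  rw [C_1, one_mul]
  change linSubst _ f = g
  rw [← linSubst_linSubst, ← hB, linSubst_linSubst,
    B.mul_nonsing_inv ((B.isUnit_iff_isUnit_det).1 hBu), linSubst_one]
end

section
/- The partial derivatives ∂₀f, …, ∂₍ₙ₊₁₎f form a regular sequence in the polynomial ring ℂ[x₀,…,x₍ₙ₊₁₎]. -/
open MvPolynomial

namespace RingTheory.Sequence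

section CommRing

variable {R : Type*} [CommRing R]

theorem isSMulRegular_quot_smul_top_iff (I : Ideal R) (r : R) :
    IsSMulRegular (R ⧸ (I • ⊤ : Submodule R R)) r ↔ ∀ z, r * z ∈ I → z ∈ I := by
  rw [isSMulRegular_quotient_iff_mem_of_smul_mem]
  simp

theorem isWeaklyRegular_self_iff (l : List R) :
    IsWeaklyRegular R l ↔ ∀ (i : ℕ) (h : i < l.length) (z : R),
      l[i] * z ∈ Ideal.ofList (l.take i) → z ∈ Ideal.ofList (l.take i) := by
  simp_rw [isWeaklyRegular_iff, isSMulRegular_quot_smul_top_iff]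

theorem isWeaklyRegular_concat_iff (l : List R) (r : R) :
    IsWeaklyRegular R (l ++ [r]) ↔
      IsWeaklyRegular R l ∧ ∀ z, r * z ∈ Ideal.ofList l → z ∈ Ideal.ofList l := by
  rw [isWeaklyRegular_append_iff, isWeaklyRegular_singleton_iff, isSMulRegular_quot_smul_top_iff]

/-- The last element of a weakly regular sequence may be replaced by any element generating,
together with the preceding ones, an ideal whose radical contains it. -/
theorem IsWeaklyRegular.replace_last {l : List R} {x y : R} (h : IsWeaklyRegular R (l ++ [x]))
    (hx : x ∈ (Ideal.ofList (l ++ [y])).radical) : IsWeaklyRegular R (l ++ [y]) := by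
  rw [isWeaklyRegular_concat_iff] at h ⊢
  refine ⟨h.1, fun z hz => ?_⟩
  obtain ⟨k, hk⟩ := hx
  have hpow : ∀ j, x ^ j * z ∈ Ideal.ofList l → z ∈ Ideal.ofList l := by
    intro j
    induction j with
    | zero => simp
    | succ j ih => exact fun hj => ih (h.2 _ (by rwa [← mul_assoc, ← pow_succ']))
  refine hpow k ?_
  rw [Ideal.ofList_append, Ideal.ofList_singleton] at hk
  obtain ⟨u, hu, v, hv, huv⟩ := Submodule.mem_sup.mp hk
  obtain ⟨w, rfl⟩ := Ideal.mem_span_singleton'.mp hv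
  rw [← huv, add_mul, mul_assoc]
  exact add_mem (Ideal.mul_mem_right _ _ hu) (Ideal.mul_mem_left _ _ hz)

theorem ofList_eq_of_perm {l l' : List R} (h : l.Perm l') : Ideal.ofList l = Ideal.ofList l' := by
  simp only [Ideal.ofList, h.mem_iff]

end CommRing

section IsLocalRing

open IsLocalRing

variable {R : Type*} [CommRing R] [IsLocalRing R] [IsNoetherianRing R]

/-- If `m` is the only prime over `I + (y)`, then it is the only prime over `I + (g)` for every
`g ∈ m` outside the minimal primes of `I`. -/
theorem maximalIdeal_le_radical_sup_span {I : Ideal R} {y g : R} (hy : y ∈ maximalIdeal R)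
    (h : maximalIdeal R ≤ (I ⊔ Ideal.span {y}).radical)
    (hg : ∀ Q ∈ I.minimalPrimes, g ∉ Q) :
    maximalIdeal R ≤ (I ⊔ Ideal.span {g}).radical := by
  rw [Ideal.radical_eq_sInf]
  refine le_sInf fun P ⟨hP, hPprime⟩ => ?_
  have hgP : g ∈ P := hP (Ideal.mem_sup_right (Ideal.mem_span_singleton_self g))
  obtain ⟨Q, hQ, hQP⟩ := Ideal.exists_minimalPrimes_le (le_sup_left.trans hP)
  have hQprime : Q.IsPrime := hQ.1.1
  have hQm : Q ≤ maximalIdeal R := le_maximalIdeal hQprime.ne_top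
  by_contra hmP
  have hPm : P ≤ maximalIdeal R := le_maximalIdeal hPprime.ne_top
  have hmin : maximalIdeal R ∈ (Q ⊔ Ideal.span {y}).minimalPrimes := by
    refine ⟨⟨inferInstance, sup_le hQm ((Ideal.span_singleton_le_iff_mem _).mpr hy)⟩, ?_⟩
    intro P' hP' _
    have := hP'.1
    exact h.trans (this.radical_le_iff.mpr ((sup_le_sup_right hQ.1.2 _).trans hP'.2))
  have hht := Ideal.map_height_le_one_of_mem_minimalPrimes hmin
  have hker {J : Ideal R} (hJ : Q ≤ J) : RingHom.ker (Ideal.Quotient.mk Q) ≤ J :=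
    (Ideal.mk_ker).trans_le hJ
  have hcomap {J : Ideal R} (hJ : Q ≤ J) :
      (J.map (Ideal.Quotient.mk Q)).comap (Ideal.Quotient.mk Q) = J := by
    rw [Ideal.comap_map_of_surjective' _ Ideal.Quotient.mk_surjective, sup_eq_left.mpr (hker hJ)]
  have h1 : (P.map (Ideal.Quotient.mk Q)).IsPrime :=
    Ideal.map_isPrime_of_surjective Ideal.Quotient.mk_surjective (hker hQP)
  have h2 : ((maximalIdeal R).map (Ideal.Quotient.mk Q)).IsPrime :=
    Ideal.map_isPrime_of_surjective Ideal.Quotient.mk_surjective (hker hQm)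
  have hlt : P.map (Ideal.Quotient.mk Q) < (maximalIdeal R).map (Ideal.Quotient.mk Q) := by
    refine lt_of_le_not_ge (Ideal.map_mono hPm) fun hle => hmP ?_
    simpa only [hcomap hQP, hcomap hQm] using
      Ideal.comap_mono (f := Ideal.Quotient.mk Q) hle
  have hP0 := (Ideal.height_le_iff (n := 1)).mp (by exact_mod_cast hht) _ h1 hlt
  have hbot : P.map (Ideal.Quotient.mk Q) = ⊥ := by
    have : (P.map (Ideal.Quotient.mk Q)).height = 0 := by
      simpa using hP0
    simpa [Ideal.height_eq_zero_iff, IsDomain.minimalPrimes_eq_singleton_bot] using this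
  have : P = Q := by
    rw [← hcomap hQP, hbot, ← RingHom.ker_eq_comap_bot, Ideal.mk_ker]
  exact hQ.1.1.ne_top (absurd (this ▸ hgP) (hg Q hQ))

theorem maximalIdeal_notMem_minimalPrimes_ofList {l : List R}
    (h : (l.length : ℕ∞) < (maximalIdeal R).height) :
    maximalIdeal R ∉ (Ideal.ofList l).minimalPrimes := by
  classical
  intro hmem
  have hset : {r | r ∈ l} = (l.toFinset : Set R) := by ext; simp
  rw [Ideal.ofList, hset] at hmem
  have := Ideal.height_le_card_of_mem_minimalPrimes_span_finset hmem
  exact absurd (h.trans_le this) (not_lt.mpr (by exact_mod_cast l.toFinset_card_le))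

theorem exists_mem_maximalIdeal_notMem_minimalPrimes {I J : Ideal R}
    (hI : maximalIdeal R ∉ I.minimalPrimes) (hJ : maximalIdeal R ∉ J.minimalPrimes) :
    ∃ g ∈ maximalIdeal R, (∀ Q ∈ I.minimalPrimes, g ∉ Q) ∧ ∀ Q ∈ J.minimalPrimes, g ∉ Q := by
  by_contra! hcon
  have hprime : ∀ Q ∈ I.minimalPrimes ∪ J.minimalPrimes, Q.IsPrime := by
    rintro Q (hQ | hQ) <;> exact hQ.1.1
  have hmem := (Ideal.subset_iUnion_iff_mem_of_isMaximal_of_finite (M := maximalIdeal R)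
    ((Ideal.finite_minimalPrimes_of_isNoetherianRing R I).union
      (Ideal.finite_minimalPrimes_of_isNoetherianRing R J)) ⊥ ⊥
    (fun Q hQ _ _ => hprime Q hQ) bot_ne_top bot_ne_top).mp fun g hg => by
      simp only [Set.mem_iUnion, exists_prop]
      by_cases h : ∀ Q ∈ I.minimalPrimes, g ∉ Q
      · obtain ⟨Q, hQ, hgQ⟩ := hcon g hg h
        exact ⟨Q, Or.inr hQ, hgQ⟩
      · push Not at h
        obtain ⟨Q, hQ, hgQ⟩ := h
        exact ⟨Q, Or.inl hQ, hgQ⟩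
  exact hmem.elim hI hJ

/-- In a Noetherian local ring, if some sequence of parameters extending `c` is weakly regular,
then so is every other one. -/
theorem isWeaklyRegular_of_maximalIdeal_le_radical (n : ℕ) :
    ∀ a b c : List R, a.length = n → b.length = n →
      (∀ r ∈ a, r ∈ maximalIdeal R) → (∀ r ∈ b, r ∈ maximalIdeal R) →
      (∀ r ∈ c, r ∈ maximalIdeal R) → (c.length + n : ℕ) ≤ (maximalIdeal R).height →
      maximalIdeal R ≤ (Ideal.ofList (c ++ a)).radical →
      maximalIdeal R ≤ (Ideal.ofList (c ++ b)).radical →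
      IsWeaklyRegular R (c ++ a) → IsWeaklyRegular R (c ++ b) := by
  induction n with
  | zero =>
    intro a b c ha hb
    rw [List.length_eq_zero_iff] at ha hb
    subst ha hb
    simp
  | succ n ih =>
    intro a b c ha hb hma hmb hmc hht hra hrb hreg
    obtain rfl | ⟨a, x, rfl⟩ := a.eq_nil_or_concat'
    · simp at ha
    obtain rfl | ⟨b, y, rfl⟩ := b.eq_nil_or_concat'
    · simp at hb
    simp only [List.length_append, List.length_singleton, Nat.add_right_cancel_iff] at ha hb
    simp only [List.mem_append, List.mem_singleton, or_imp, forall_and, forall_eq] at hma hmb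
    rw [← List.append_assoc] at hra hrb hreg ⊢
    have hlt : ((c.length + n : ℕ) : ℕ∞) < (maximalIdeal R).height :=
      lt_of_lt_of_le (by exact_mod_cast Nat.lt_succ_self _) hht
    obtain ⟨g, hg, hga, hgb⟩ := exists_mem_maximalIdeal_notMem_minimalPrimes
      (maximalIdeal_notMem_minimalPrimes_ofList (l := c ++ a) (by simpa [ha] using hlt))
      (maximalIdeal_notMem_minimalPrimes_ofList (l := c ++ b) (by simpa [hb] using hlt))
    have hrga : maximalIdeal R ≤ (Ideal.ofList (c ++ a ++ [g])).radical := by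
      rw [Ideal.ofList_append, Ideal.ofList_singleton] at hra ⊢
      exact maximalIdeal_le_radical_sup_span hma.2 hra hga
    have hrgb : maximalIdeal R ≤ (Ideal.ofList (c ++ b ++ [g])).radical := by
      rw [Ideal.ofList_append, Ideal.ofList_singleton] at hrb ⊢
      exact maximalIdeal_le_radical_sup_span hmb.2 hrb hgb
    have hperm (l : List R) : (c ++ l ++ [g]).Perm (c ++ [g] ++ l) := by
      simpa only [List.append_assoc] using List.perm_append_comm.append_left c
    have hrega : IsWeaklyRegular R (c ++ [g] ++ a) := by
      refine IsLocalRing.isWeaklyRegular_of_perm_of_subset_maximalIdeal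
        (hreg.replace_last (hrga hma.2)) (hperm a) ?_
      simp only [List.mem_append, List.mem_singleton]
      rintro r ((hr | hr) | rfl)
      exacts [hmc r hr, hma.1 r hr, hg]
    have hmcg : ∀ r ∈ c ++ [g], r ∈ maximalIdeal R := by
      simp only [List.mem_append, List.mem_singleton]
      rintro r (hr | rfl)
      exacts [hmc r hr, hg]
    have hregb : IsWeaklyRegular R (c ++ [g] ++ b) := by
      refine ih a b (c ++ [g]) ha hb hma.1 hmb.1 hmcg ?_ ?_ ?_ hrega
      · simpa [add_assoc, add_comm, add_left_comm] using hht
      · rwa [← ofList_eq_of_perm (hperm a)]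
      · rwa [← ofList_eq_of_perm (hperm b)]
    refine (IsLocalRing.isWeaklyRegular_of_perm_of_subset_maximalIdeal hregb
      (hperm b).symm ?_).replace_last (hrb hg)
    simp only [List.mem_append]
    rintro r (hr | hr)
    exacts [hmcg r (List.mem_append.mpr hr), hmb.1 r hr]

theorem IsRegular.length_le_height_maximalIdeal {l : List R} (h : IsRegular R l) :
    (l.length : ℕ∞) ≤ (maximalIdeal R).height := by
  have hdim := ringKrullDim_add_length_eq_ringKrullDim_of_isRegular l h
  rw [← maximalIdeal_height_eq_ringKrullDim (R := R)] at hdim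
  have hne : Nontrivial (R ⧸ Ideal.ofList l) :=
    Ideal.Quotient.nontrivial_iff.mpr fun htop => h.top_ne_smul (by simp [htop])
  have h0 : 0 ≤ ringKrullDim (R ⧸ Ideal.ofList l) := ringKrullDim_nonneg_of_nontrivial
  have : ((l.length : ℕ∞) : WithBot ℕ∞) ≤ ((maximalIdeal R).height : WithBot ℕ∞) := by
    rw [← hdim]
    exact le_add_of_nonneg_left h0
  exact_mod_cast this

end IsLocalRing

end RingTheory.Sequence

namespace MvPolynomial

open RingTheory.Sequence

attribute [local instance] gradedAlgebra

theorem idealOfVars_eq_ker_constantCoeff (σ R : Type*) [CommRing R] :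
    idealOfVars σ R = RingHom.ker (constantCoeff : MvPolynomial σ R →+* R) := by
  refine le_antisymm (Ideal.span_le.mpr ?_) fun p hp => ?_
  · rintro _ ⟨i, rfl⟩
    simp [RingHom.mem_ker]
  · rw [idealOfVars, ← Set.image_univ, mem_ideal_span_X_image]
    intro m hm
    by_contra! h
    obtain rfl : m = 0 := Finsupp.ext fun i => h i (Set.mem_univ i)
    exact mem_support_iff.mp hm hp

instance isPrime_idealOfVars (σ R : Type*) [CommRing R] [IsDomain R] :
    (idealOfVars σ R).IsPrime := by
  rw [idealOfVars_eq_ker_constantCoeff]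
  exact RingHom.ker_isPrime _

theorem isWeaklyRegular_ofFn_X (R : Type*) [CommRing R] (n : ℕ) :
    IsWeaklyRegular (MvPolynomial (Fin n) R)
      (List.ofFn fun i : Fin n => (X i : MvPolynomial (Fin n) R)) := by
  rw [isWeaklyRegular_self_iff]
  intro i hi z hz
  rw [List.length_ofFn] at hi
  have hlist : {r | r ∈ (List.ofFn fun i : Fin n => (X i : MvPolynomial (Fin n) R)).take i} =
      X '' {j : Fin n | (j : ℕ) < i} := by
    ext r
    simp only [Set.mem_ofPred_eq, List.mem_take_iff_getElem, List.getElem_ofFn, List.length_ofFn,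
      Set.mem_image, lt_min_iff]
    constructor
    · rintro ⟨j, hj, rfl⟩
      exact ⟨⟨j, hj.2⟩, hj.1, rfl⟩
    · rintro ⟨j, hj, rfl⟩
      exact ⟨j, ⟨hj, j.2⟩, rfl⟩
  rw [Ideal.ofList, hlist, mem_ideal_span_X_image] at hz ⊢
  intro m hm
  obtain ⟨j, hj, hjm⟩ := hz (Finsupp.single ⟨i, hi⟩ 1 + m) (by
    rw [mem_support_iff] at hm ⊢
    rwa [List.getElem_ofFn, coeff_X_mul])
  refine ⟨j, hj, ?_⟩
  have hne : (⟨i, hi⟩ : Fin n) ≠ j := by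
    rintro rfl
    exact lt_irrefl i hj
  simpa [Finsupp.single_apply, hne] using hjm

/-- Regularity of a homogeneous element modulo a homogeneous ideal may be tested after
localizing at the origin. -/
theorem mem_of_mul_mem_of_isHomogeneous {σ k : Type*} [Field k] {I : Ideal (MvPolynomial σ k)}
    (hI : I.IsHomogeneous (homogeneousSubmodule σ k)) {g : MvPolynomial σ k} {e : ℕ}
    (hg : g.IsHomogeneous e)
    (hloc : ∀ z, g * z ∈ I → ∃ s ∉ idealOfVars σ k, s * z ∈ I)
    {z : MvPolynomial σ k} (hz : g * z ∈ I) : z ∈ I := by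
  rw [hI.mem_iff]
  intro j
  have hgz : g * (DirectSum.decompose (homogeneousSubmodule σ k) z j) ∈ I := by
    rw [← DirectSum.coe_decompose_mul_add_of_left_mem (homogeneousSubmodule σ k) (i := e) hg]
    exact (hI.mem_iff.mp hz) _
  obtain ⟨s, hs, hsz⟩ := hloc _ hgz
  have hcomp := (hI.mem_iff.mp hsz) (0 + j)
  rw [DirectSum.coe_decompose_mul_add_of_right_mem (homogeneousSubmodule σ k) (i := 0)
    (SetLike.coe_mem _)] at hcomp
  have hs0 : (DirectSum.decompose (homogeneousSubmodule σ k) s 0 : MvPolynomial σ k) =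
      C (constantCoeff s) :=
    (decomposition.decompose'_apply s 0).trans (homogeneousComponent_zero s)
  rw [idealOfVars_eq_ker_constantCoeff, RingHom.mem_ker] at hs
  rw [hs0] at hcomp
  have hunit : IsUnit (C (constantCoeff s) : MvPolynomial σ k) := (Ne.isUnit hs).map C
  exact (Ideal.unit_mul_mem_iff_mem I hunit).mp hcomp

/-- Over an algebraically closed field, `n` forms of positive degree in `n` variables whose only
common zero is the origin form a regular sequence. -/
theorem isRegular_ofFn_of_isHomogeneous {k : Type*} [Field k] [IsAlgClosed k] {n : ℕ}
    (F : Fin n → MvPolynomial (Fin n) k) (e : Fin n → ℕ) (he : ∀ i, e i ≠ 0)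
    (hF : ∀ i, (F i).IsHomogeneous (e i))
    (hzero : ∀ x : Fin n → k, (∀ i, eval x (F i) = 0) → x = 0) :
    IsRegular (MvPolynomial (Fin n) k) (List.ofFn F) := by
  set P := idealOfVars (Fin n) k with hP
  set A := Localization.AtPrime P
  set φ := algebraMap (MvPolynomial (Fin n) k) A
  have hFP : ∀ r ∈ List.ofFn F, r ∈ P := by
    intro r hr
    obtain ⟨i, rfl⟩ := (List.mem_ofFn' _ _).mp hr
    rw [hP, idealOfVars_eq_ker_constantCoeff, RingHom.mem_ker, constantCoeff_eq]
    exact (hF i).coeff_eq_zero (by simpa using (he i).symm)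
  have hXP : ∀ r ∈ List.ofFn fun i : Fin n => (X i : MvPolynomial (Fin n) k), r ∈ P := by
    intro r hr
    obtain ⟨i, rfl⟩ := (List.mem_ofFn' _ _).mp hr
    exact Ideal.subset_span ⟨i, rfl⟩
  have hXrad : P ≤ (Ideal.ofList (List.ofFn fun i : Fin n =>
      (X i : MvPolynomial (Fin n) k))).radical := by
    refine le_trans (Ideal.span_mono ?_) Ideal.le_radical
    rintro _ ⟨i, rfl⟩
    exact (List.mem_ofFn' _ _).mpr ⟨i, rfl⟩
  have hFrad : P ≤ (Ideal.ofList (List.ofFn F)).radical := by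
    rw [← vanishingIdeal_zeroLocus_eq_radical (K := k)]
    refine Ideal.span_le.mpr ?_
    rintro _ ⟨i, rfl⟩
    rw [SetLike.mem_coe, mem_vanishingIdeal_iff]
    intro x hx
    have : x = 0 := hzero x fun j => by
      simpa [aeval_eq_eval] using hx (F j) (Ideal.subset_span ((List.mem_ofFn' _ _).mpr ⟨j, rfl⟩))
    simp [this]
  have hmap {l : List (MvPolynomial (Fin n) k)} (h : P ≤ (Ideal.ofList l).radical) :
      IsLocalRing.maximalIdeal A ≤ (Ideal.ofList ([] ++ l.map φ)).radical := by
    rw [List.nil_append, ← Ideal.map_ofList, ← Localization.AtPrime.map_eq_maximalIdeal]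
    exact (Ideal.map_mono h).trans (Ideal.map_radical_le _)
  have hmem {l : List (MvPolynomial (Fin n) k)} (h : ∀ r ∈ l, r ∈ P) :
      ∀ r ∈ l.map φ, r ∈ IsLocalRing.maximalIdeal A := by
    simp only [List.mem_map]
    rintro _ ⟨r, hr, rfl⟩
    exact (IsLocalization.AtPrime.to_map_mem_maximal_iff A P r).mpr (h r hr)
  have hXreg := (isWeaklyRegular_ofFn_X k n).isRegular_of_isLocalization_of_mem A P hXP
  have hFreg : IsWeaklyRegular A ((List.ofFn F).map φ) :=
    isWeaklyRegular_of_maximalIdeal_le_radical n _ _ [] (by simp) (by simp) (hmem hXP) (hmem hFP)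
      (by simp) (by simpa using hXreg.length_le_height_maximalIdeal) (hmap hXrad) (hmap hFrad)
      hXreg.toIsWeaklyRegular
  refine ⟨(isWeaklyRegular_self_iff _).mpr fun i hi z hz => ?_, fun htop => ?_⟩
  · have hi' : i < n := by simpa using hi
    refine mem_of_mul_mem_of_isHomogeneous (e := e ⟨i, hi'⟩) ?_ (by simpa using hF ⟨i, hi'⟩) ?_ hz
    · refine Ideal.homogeneous_span (homogeneousSubmodule (Fin n) k) _ fun r hr => ?_
      obtain ⟨j, rfl⟩ := (List.mem_ofFn' _ _).mp (List.mem_of_mem_take hr)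
      exact ⟨e j, hF j⟩
    · intro w hw
      have := (isWeaklyRegular_self_iff _).mp hFreg i (by simpa using hi') (φ w) (by
        rw [List.getElem_map, ← map_mul, ← List.map_take, ← Ideal.map_ofList]
        exact Ideal.mem_map_of_mem φ hw)
      rw [← List.map_take, ← Ideal.map_ofList,
        IsLocalization.algebraMap_mem_map_algebraMap_iff P.primeCompl] at this
      exact this
  · refine (isPrime_idealOfVars (Fin n) k).ne_top (top_le_iff.mp ?_)
    rw [htop, smul_eq_mul, Ideal.mul_top]
    exact Ideal.span_le.mpr hFP

end MvPolynomial

theorem partial_derivatives_regular_sequence (n d : ℕ) (hn : 1 ≤ n) (hd : 2 ≤ d)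
    (f : MvPolynomial (Fin (n + 2)) ℂ) (hf : f.IsHomogeneous d)
    (hsm : ∀ x : Fin (n + 2) → ℂ, (∀ i, eval x (pderiv i f) = 0) → x = 0) :
    RingTheory.Sequence.IsRegular (MvPolynomial (Fin (n + 2)) ℂ)
      (List.ofFn fun i : Fin (n + 2) => pderiv i f) :=
  MvPolynomial.isRegular_ofFn_of_isHomogeneous _ (fun _ => d - 1) (fun _ => by omega)
    (fun _ => hf.pderiv) hsm
end
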